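/- arXiv:1402.7192 — 2 statements merged into one kernel-verified Lean document; each statement's English description precedes it below -/
import Mathlib

section
/- Let 1 ≤ p < ∞ and let f ∈ U_p(ℝ²). Then f can be modified on a set of measure zero so as to become uniformly continuous and bounded on ℝ²; that is, there exists a bounded, uniformly continuous function f̄ on ℝ² with f = f̄ almost everywhere. Moreover, there is a constant c depending only on p such that the modulus of continuity satisfies ω(f̄; δ) ≤ c ∫₀^δ [φ₁*(t) + φ₂*(t)] t^{1/p − 1} dt for all δ > 0, where φ₁(y) = ‖f_y‖*_{Lip 1/p} and φ₂(x) = ‖f_x‖*_{Lip 1/p}. -/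
open MeasureTheory Set
open scoped ENNReal

noncomputable section

/-- Extended essential sup norm on ℝ. -/
def einf (φ : ℝ → ℝ) : ℝ≥0∞ := eLpNorm φ ⊤ volume

/-- Lipschitz `α` seminorm (extended real valued):
`sup_{h>0} h^{-α} ‖φ(·+h) - φ‖_∞`. -/
def lipSemiE (α : ℝ) (φ : ℝ → ℝ) : ℝ≥0∞ :=
  ⨆ h ∈ Ioi (0:ℝ), ENNReal.ofReal (h ^ (-α)) * einf (fun x => φ (x + h) - φ x)

/-- Real-valued Lipschitz `α` seminorm `‖φ‖*_{Lip α}`. -/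
def lipSemi (α : ℝ) (φ : ℝ → ℝ) : ℝ := (lipSemiE α φ).toReal

/-- `φ ∈ Lip α`: essentially bounded with finite Lipschitz `α` seminorm. -/
def MemLip (α : ℝ) (φ : ℝ → ℝ) : Prop := einf φ < ⊤ ∧ lipSemiE α φ < ⊤

/-- `‖φ‖_{Lip α} = ‖φ‖_∞ + ‖φ‖*_{Lip α}`. -/
def lipNorm (α : ℝ) (φ : ℝ → ℝ) : ℝ := (einf φ + lipSemiE α φ).toReal

/-- The class `S₀`: measurable functions with finite distribution function at every
positive level. -/
def S0 {X : Type*} [MeasureSpace X] (f : X → ℝ) : Prop :=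
  Measurable f ∧ ∀ s : ℝ, 0 < s → volume {x | s < |f x|} < ⊤

/-- The non-increasing rearrangement `f*`. -/
def rearr {X : Type*} [MeasureSpace X] (f : X → ℝ) (t : ℝ) : ℝ :=
  sInf {s : ℝ | 0 ≤ s ∧ volume {x | s < |f x|} ≤ ENNReal.ofReal t}

/-- `f**(t) = (1/t) ∫₀^t f*(u) du`. -/
def doubleStar {X : Type*} [MeasureSpace X] (f : X → ℝ) (t : ℝ) : ℝ :=
  (∫ u in Ioc (0:ℝ) t, rearr f u) / t

/-- Lorentz `L^{p,q}` norm. -/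
def lorentzNorm {X : Type*} [MeasureSpace X] (p q : ℝ) (f : X → ℝ) : ℝ :=
  (∫ t in Ioi (0:ℝ), (t ^ (1/p) * rearr f t) ^ q / t) ^ (1/q)

/-- Membership in the Lorentz space `L^{p,q}`. -/
def MemLorentz {X : Type*} [MeasureSpace X] (p q : ℝ) (f : X → ℝ) : Prop :=
  S0 f ∧ IntegrableOn (fun t => (t ^ (1/p) * rearr f t) ^ q / t) (Ioi (0:ℝ))

/-- The space `U_p(ℝ²)`: a.e. sections in `Lip (1/p)`, with `Lip (1/p)` norms of the
sections in `L^{p,1}(ℝ)`. -/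
def MemUp (p : ℝ) (f : ℝ × ℝ → ℝ) : Prop :=
  Measurable f ∧
  (∀ᵐ y : ℝ ∂volume, MemLip (1/p) (fun x => f (x, y))) ∧
  (∀ᵐ x : ℝ ∂volume, MemLip (1/p) (fun y => f (x, y))) ∧
  MemLorentz p 1 (fun y => lipNorm (1/p) (fun x => f (x, y))) ∧
  MemLorentz p 1 (fun x => lipNorm (1/p) (fun y => f (x, y)))

/-- The Steklov-type average `f_h`. -/
def avg (f : ℝ × ℝ → ℝ) (h : ℝ) (z : ℝ × ℝ) : ℝ :=
  (∫ u in Ioc (0:ℝ) h, ∫ v in Ioc (0:ℝ) h, f (z.1 + u, z.2 + v)) / h ^ 2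

theorem measurableSet_setOf_ae {X Y : Type*} [MeasurableSpace X] [MeasurableSpace Y]
    {ν : Measure Y} [SFinite ν] {q : X × Y → Prop} (hq : MeasurableSet {z | q z}) :
    MeasurableSet {x | ∀ᵐ y ∂ν, q (x, y)} := by
  have h := measurable_measure_prodMk_left (ν := ν) hq.compl
  exact h (measurableSet_singleton 0)

theorem measurable_essSup_prodMk {X Y : Type*} [MeasurableSpace X] [MeasurableSpace Y]
    {ν : Measure Y} [SFinite ν] {F : X × Y → ℝ≥0∞} (hF : Measurable F) :
    Measurable fun x => essSup (fun y => F (x, y)) ν := by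
  refine measurable_of_Iic fun a => ?_
  have : (fun x => essSup (fun y => F (x, y)) ν) ⁻¹' Iic a = {x | ∀ᵐ y ∂ν, F (x, y) ≤ a} := by
    ext x
    exact ⟨fun h => (ENNReal.ae_le_essSup fun y => F (x, y)).mono fun y hy => hy.trans h,
      fun h => essSup_le_of_ae_le a h⟩
  rw [this]
  exact measurableSet_setOf_ae (hF measurableSet_Iic)

/-- The Hölder seminorm of order `α` controls the difference quotients of order `α` at almost
every pair of points. -/
theorem ae_ofReal_abs_sub_mul_rpow_le_lipSemiE {φ : ℝ → ℝ} (hφ : Measurable φ) (α : ℝ) :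
    ∀ᵐ q : ℝ × ℝ, ENNReal.ofReal (|φ q.1 - φ q.2| * |q.1 - q.2| ^ (-α)) ≤ lipSemiE α φ := by
  have hpos : ∀ h : ℝ, 0 < h → ∀ᵐ x : ℝ,
      ENNReal.ofReal (|φ x - φ (x + h)| * |x - (x + h)| ^ (-α)) ≤ lipSemiE α φ := by
    intro h hh
    have h1 : ENNReal.ofReal (h ^ (-α)) * einf (fun x => φ (x + h) - φ x) ≤ lipSemiE α φ :=
      le_iSup₂ (f := fun (h : ℝ) (_ : h ∈ Ioi (0:ℝ)) =>
        ENNReal.ofReal (h ^ (-α)) * einf (fun x => φ (x + h) - φ x)) h hh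
    have h2 : ∀ᵐ x : ℝ, ‖φ (x + h) - φ x‖ₑ ≤ einf (fun x => φ (x + h) - φ x) := by
      rw [einf, eLpNorm_exponent_top]
      exact enorm_ae_le_eLpNormEssSup _ _
    filter_upwards [h2] with x hx
    refine le_trans ?_ h1
    rw [mul_comm, ENNReal.ofReal_mul (by positivity), abs_sub_comm (φ x)]
    have e : |x - (x + h)| = h := by
      rw [abs_sub_comm]; simp [abs_of_pos hh]
    rw [e, ← Real.enorm_eq_ofReal_abs]
    gcongr
  have hne : ∀ h : ℝ, h ≠ 0 → ∀ᵐ x : ℝ,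
      ENNReal.ofReal (|φ x - φ (x + h)| * |x - (x + h)| ^ (-α)) ≤ lipSemiE α φ := by
    intro h hh
    rcases lt_or_gt_of_ne hh with h' | h'
    · have := (measurePreserving_add_right (volume : Measure ℝ) h).quasiMeasurePreserving.ae
        (hpos (-h) (by linarith))
      filter_upwards [this] with x hx
      rw [abs_sub_comm (φ x), abs_sub_comm x]
      simpa using hx
    · exact hpos h h'
  have hm : MeasurableSet {z : ℝ × ℝ |
      ENNReal.ofReal (|φ z.2 - φ (z.2 + z.1)| * |z.2 - (z.2 + z.1)| ^ (-α)) ≤ lipSemiE α φ} :=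
    measurableSet_le (by fun_prop) measurable_const
  have hae : ∀ᵐ z : ℝ × ℝ,
      ENNReal.ofReal (|φ z.2 - φ (z.2 + z.1)| * |z.2 - (z.2 + z.1)| ^ (-α)) ≤ lipSemiE α φ := by
    rw [Measure.volume_eq_prod, Measure.ae_prod_iff_ae_ae hm]
    filter_upwards [Measure.ae_ne volume (0:ℝ)] with h hh
    exact hne h hh
  have hmp : MeasurePreserving (fun z : ℝ × ℝ => (z.2 - z.1, z.1)) volume volume := by
    have h1 : MeasurePreserving (fun z : ℝ × ℝ => (z.1, -z.1 + z.2)) (volume.prod volume)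
        (volume.prod volume) := measurePreserving_prod_neg_add volume volume
    have h2 := (Measure.measurePreserving_swap (μ := (volume : Measure ℝ))
      (ν := (volume : Measure ℝ))).comp h1
    rw [Measure.volume_eq_prod]
    have e : (fun z : ℝ × ℝ => (z.2 - z.1, z.1)) =
        Prod.swap ∘ fun z : ℝ × ℝ => (z.1, -z.1 + z.2) := by
      funext z; simp [sub_eq_neg_add]
    rw [e]
    exact h2
  filter_upwards [hmp.quasiMeasurePreserving.ae hae] with q hq
  simpa using hq

/-- The two Hölder-type bounds along coordinate lines combine to a bound at almost every pair
of points of the plane. -/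
theorem ae_ae_abs_sub_le_add {f : ℝ × ℝ → ℝ} (hf : Measurable f) {α : ℝ} {g₁ g₂ : ℝ → ℝ}
    (hg₁ : Measurable g₁) (hg₂ : Measurable g₂)
    (h₁ : ∀ᵐ y : ℝ, ∀ᵐ q : ℝ × ℝ, |f (q.1, y) - f (q.2, y)| ≤ g₁ y * |q.1 - q.2| ^ α)
    (h₂ : ∀ᵐ x : ℝ, ∀ᵐ q : ℝ × ℝ, |f (x, q.1) - f (x, q.2)| ≤ g₂ x * |q.1 - q.2| ^ α) :
    ∀ᵐ z : ℝ × ℝ, ∀ᵐ w : ℝ × ℝ,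
      |f z - f w| ≤ g₁ z.2 * |z.1 - w.1| ^ α + g₂ w.1 * |z.2 - w.2| ^ α := by
  have hA : ∀ᵐ z : ℝ × ℝ, ∀ᵐ u : ℝ, |f z - f (u, z.2)| ≤ g₁ z.2 * |z.1 - u| ^ α := by
    have hm : MeasurableSet {t : (ℝ × ℝ) × ℝ |
        |f (t.1.2, t.1.1) - f (t.2, t.1.1)| ≤ g₁ t.1.1 * |t.1.2 - t.2| ^ α} :=
      measurableSet_le (by fun_prop) (by fun_prop)
    have h : ∀ᵐ z : ℝ × ℝ, ∀ᵐ u : ℝ, |f (z.2, z.1) - f (u, z.1)| ≤ g₁ z.1 * |z.2 - u| ^ α := by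
      rw [Measure.volume_eq_prod, Measure.ae_prod_iff_ae_ae (measurableSet_setOf_ae hm)]
      filter_upwards [h₁] with y hy
      exact Measure.ae_ae_of_ae_prod hy
    have := (Measure.measurePreserving_swap (μ := (volume : Measure ℝ))
      (ν := (volume : Measure ℝ))).quasiMeasurePreserving.ae h
    exact this
  have hB : ∀ᵐ z : ℝ × ℝ, ∀ᵐ u : ℝ, ∀ᵐ v : ℝ,
      |f (u, z.2) - f (u, v)| ≤ g₂ u * |z.2 - v| ^ α := by
    have hm : MeasurableSet {t : (ℝ × ℝ) × ℝ |
        |f (t.1.1, t.1.2) - f (t.1.1, t.2)| ≤ g₂ t.1.1 * |t.1.2 - t.2| ^ α} :=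
      measurableSet_le (by fun_prop) (by fun_prop)
    have h : ∀ᵐ u : ℝ, ∀ᵐ y : ℝ, ∀ᵐ v : ℝ, |f (u, y) - f (u, v)| ≤ g₂ u * |y - v| ^ α := by
      filter_upwards [h₂] with x hx
      exact Measure.ae_ae_of_ae_prod hx
    have h' := (Measure.ae_ae_comm
      (p := fun u y : ℝ => ∀ᵐ v : ℝ, |f (u, y) - f (u, v)| ≤ g₂ u * |y - v| ^ α)
      (measurableSet_setOf_ae hm)).1 h
    exact Measure.quasiMeasurePreserving_snd.ae h'
  filter_upwards [hA, hB] with z hzA hzB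
  have hm : MeasurableSet {w : ℝ × ℝ |
      |f z - f w| ≤ g₁ z.2 * |z.1 - w.1| ^ α + g₂ w.1 * |z.2 - w.2| ^ α} :=
    measurableSet_le (by fun_prop) (by fun_prop)
  rw [Measure.volume_eq_prod, Measure.ae_prod_iff_ae_ae hm]
  filter_upwards [hzA, hzB] with u hu hu'
  filter_upwards [hu'] with v hv
  calc |f z - f (u, v)| ≤ |f z - f (u, z.2)| + |f (u, z.2) - f (u, v)| := abs_sub_le _ _ _
    _ ≤ _ := add_le_add hu hv

/-- A measurable minorant of the Hölder seminorms of the sections that still bounds the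
increments of almost every section. -/
theorem exists_measurable_le_lipSemi {f : ℝ × ℝ → ℝ} (hf : Measurable f) {α : ℝ} (hα : 0 < α)
    (h : ∀ᵐ y : ℝ, lipSemiE α (fun x => f (x, y)) < ⊤) :
    ∃ g : ℝ → ℝ, Measurable g ∧ (∀ᵐ y : ℝ, g y ≤ lipSemi α (fun x => f (x, y))) ∧
      ∀ᵐ y : ℝ, ∀ᵐ q : ℝ × ℝ, |f (q.1, y) - f (q.2, y)| ≤ g y * |q.1 - q.2| ^ α := by
  let F : ℝ × ℝ × ℝ → ℝ≥0∞ := fun t =>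
    ENNReal.ofReal (|f (t.2.1, t.1) - f (t.2.2, t.1)| * |t.2.1 - t.2.2| ^ (-α))
  have hF : Measurable F := by fun_prop
  have hle : ∀ y, essSup (fun q => F (y, q)) volume ≤ lipSemiE α (fun x => f (x, y)) := fun y =>
    essSup_le_of_ae_le _ (ae_ofReal_abs_sub_mul_rpow_le_lipSemiE (by fun_prop) α)
  refine ⟨fun y => (essSup (fun q => F (y, q)) volume).toReal,
    (measurable_essSup_prodMk hF).ennreal_toReal, ?_, ?_⟩
  · filter_upwards [h] with y hy
    exact ENNReal.toReal_mono hy.ne (hle y)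
  · filter_upwards [h] with y hy
    filter_upwards [ENNReal.ae_le_essSup (μ := volume) fun q => F (y, q)] with q hq
    have hq' := (ENNReal.ofReal_le_iff_le_toReal ((hle y).trans_lt hy).ne).1 hq
    rcases eq_or_ne q.1 q.2 with e | e
    · simp [e, Real.zero_rpow hα.ne']
    · have hpos : 0 < |q.1 - q.2| := abs_pos.2 (sub_ne_zero.2 e)
      rw [Real.rpow_neg hpos.le, ← div_eq_mul_inv, div_le_iff₀ (by positivity)] at hq'
      exact hq'

theorem rearr_nonneg {X : Type*} [MeasureSpace X] (f : X → ℝ) (t : ℝ) : 0 ≤ rearr f t :=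
  Real.sInf_nonneg fun _ hs => hs.1

theorem S0.exists_measure_lt_le {X : Type*} [MeasureSpace X] {f : X → ℝ} (hf : S0 f) {t : ℝ}
    (ht : 0 < t) : ∃ s : ℝ, 0 ≤ s ∧ volume {x | s < |f x|} ≤ ENNReal.ofReal t := by
  have hlim : Filter.Tendsto (fun n : ℕ => volume {x | ((n : ℝ) + 1) < |f x|}) Filter.atTop
      (nhds (volume (⋂ n : ℕ, {x | ((n : ℝ) + 1) < |f x|}))) := by
    refine tendsto_measure_iInter_atTop (fun n => ?_) ?_ ⟨0, ?_⟩
    · exact (measurableSet_lt measurable_const hf.1.abs).nullMeasurableSet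
    · intro m n hmn x hx
      simp only [mem_ofPred_eq] at hx ⊢
      have : (m : ℝ) ≤ n := by exact_mod_cast hmn
      linarith
    · exact (hf.2 _ (by positivity)).ne
  have hempty : (⋂ n : ℕ, {x | ((n : ℝ) + 1) < |f x|}) = ∅ := by
    refine eq_empty_of_forall_notMem fun x hx => ?_
    obtain ⟨n, hn⟩ := exists_nat_gt |f x|
    have h : ((n : ℝ) + 1) < |f x| := mem_iInter.1 hx n
    linarith
  rw [hempty, measure_empty] at hlim
  obtain ⟨n, hn⟩ := (hlim.eventually (ge_mem_nhds (ENNReal.ofReal_pos.2 ht))).exists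
  exact ⟨n + 1, by positivity, hn⟩

theorem measure_rearr_lt_le {X : Type*} [MeasureSpace X] {f : X → ℝ} {t : ℝ}
    (h : ∃ s : ℝ, 0 ≤ s ∧ volume {x | s < |f x|} ≤ ENNReal.ofReal t) :
    volume {x | rearr f t < |f x|} ≤ ENNReal.ofReal t := by
  have hU : {x | rearr f t < |f x|} = ⋃ n : ℕ, {x | rearr f t + 1 / ((n : ℝ) + 1) < |f x|} := by
    ext x
    simp only [mem_ofPred_eq, mem_iUnion]
    constructor
    · intro hx
      obtain ⟨n, hn⟩ := exists_nat_one_div_lt (sub_pos.2 hx)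
      exact ⟨n, by linarith⟩
    · rintro ⟨n, hn⟩
      have : 0 < 1 / ((n : ℝ) + 1) := by positivity
      linarith
  have hmono : Monotone fun n : ℕ => {x | rearr f t + 1 / ((n : ℝ) + 1) < |f x|} := by
    intro m n hmn x hx
    simp only [mem_ofPred_eq] at hx ⊢
    have := Nat.one_div_le_one_div (α := ℝ) hmn
    linarith
  rw [hU, hmono.measure_iUnion]
  refine iSup_le fun n => ?_
  obtain ⟨s, hs, hlt⟩ := exists_lt_of_csInf_lt h
    (show rearr f t < rearr f t + 1 / ((n : ℝ) + 1) by
      have : 0 < 1 / ((n : ℝ) + 1) := by positivity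
      linarith)
  exact (measure_mono fun x (hx : _ < _) => hlt.trans hx).trans hs.2

theorem rearr_le_rearr {X : Type*} [MeasureSpace X] {f g : X → ℝ} {t t' : ℝ}
    (hfg : ∀ᵐ x, |f x| ≤ |g x|) (htt' : t ≤ t')
    (h : ∃ s : ℝ, 0 ≤ s ∧ volume {x | s < |g x|} ≤ ENNReal.ofReal t) :
    rearr f t' ≤ rearr g t := by
  refine csInf_le_csInf ⟨0, fun s hs => hs.1⟩ h fun s hs => ⟨hs.1, ?_⟩
  refine le_trans (measure_mono_ae ?_) (hs.2.trans (ENNReal.ofReal_le_ofReal htt'))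
  filter_upwards [hfg] with x hx hlt
  exact lt_of_lt_of_le hlt hx

/-- Near every point of the plane there is a generic point whose coordinates avoid two given
small sets. -/
theorem exists_near_of_ae (z : ℝ × ℝ) {r : ℝ} {b₁ b₂ : Set ℝ}
    (h₁ : volume b₁ < ENNReal.ofReal (2 * r)) (h₂ : volume b₂ < ENNReal.ofReal (2 * r))
    {Q : ℝ × ℝ → Prop} (hQ : ∀ᵐ w, Q w) :
    ∃ w : ℝ × ℝ, |w.1 - z.1| ≤ r ∧ |w.2 - z.2| ≤ r ∧ w.1 ∉ b₁ ∧ w.2 ∉ b₂ ∧ Q w := by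
  have hpos : ∀ (a : ℝ) (b : Set ℝ), volume b < ENNReal.ofReal (2 * r) →
      volume (Icc (a - r) (a + r) \ b) ≠ 0 := by
    intro a b hb h0
    have h : volume (Icc (a - r) (a + r)) ≤ volume b := by
      calc volume (Icc (a - r) (a + r)) ≤ volume (b ∪ Icc (a - r) (a + r) \ b) :=
            measure_mono (by rw [union_sdiff_self]; exact subset_union_right)
        _ ≤ volume b + volume (Icc (a - r) (a + r) \ b) := measure_union_le _ _
        _ = volume b := by rw [h0, add_zero]
    rw [Real.volume_Icc, show a + r - (a - r) = 2 * r by ring] at h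
    exact absurd hb (not_lt.2 h)
  by_contra! hno
  have hsub : (Icc (z.1 - r) (z.1 + r) \ b₁) ×ˢ (Icc (z.2 - r) (z.2 + r) \ b₂) ⊆ {w | ¬ Q w} := by
    rintro w ⟨⟨hw₁, hb₁⟩, hw₂, hb₂⟩
    exact hno w (abs_le.2 ⟨by linarith [hw₁.1], by linarith [hw₁.2]⟩)
      (abs_le.2 ⟨by linarith [hw₂.1], by linarith [hw₂.2]⟩) hb₁ hb₂
  have h0 := measure_mono_null hsub (ae_iff.1 hQ)
  rw [Measure.volume_eq_prod, Measure.prod_prod, mul_eq_zero] at h0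
  exact h0.elim (hpos _ _ h₁) (hpos _ _ h₂)

/-- A function whose oscillation on a conull set is controlled by a modulus agrees almost
everywhere with a uniformly continuous function having the same control. -/
theorem exists_uniformContinuous_ae_eq {X : Type*} [PseudoMetricSpace X] [MeasurableSpace X]
    {μ : Measure X} [μ.IsOpenPosMeasure] {f : X → ℝ} {T : Set X} (hT : ∀ᵐ z ∂μ, z ∈ T)
    {Ω : ℝ → ℝ} (hΩ : Filter.Tendsto Ω (nhdsWithin 0 (Ioi 0)) (nhds 0))
    (hosc : ∀ z ∈ T, ∀ w ∈ T, ∀ δ : ℝ, 0 < δ → dist z w < 2 * δ → |f z - f w| ≤ Ω δ)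
    {M : ℝ} (hM : ∀ z ∈ T, |f z| ≤ M) :
    ∃ F : X → ℝ, UniformContinuous F ∧ (∀ z, |F z| ≤ M) ∧ f =ᵐ[μ] F ∧
      ∀ δ : ℝ, 0 < δ → ∀ z w, dist z w ≤ δ → |F z - F w| ≤ Ω δ := by
  have hd : Dense T := Measure.dense_of_ae hT
  have huc : UniformContinuous (T.domRestrict f) := by
    rw [Metric.uniformContinuous_iff]
    intro ε hε
    obtain ⟨δ, hδΩ, hδ⟩ := ((hΩ.eventually (gt_mem_nhds hε)).and self_mem_nhdsWithin).exists
    have hδ' : 0 < δ := hδ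
    refine ⟨2 * δ, by positivity, fun {a b} hab => ?_⟩
    exact (hosc a a.2 b b.2 δ hδ' hab).trans_lt hδΩ
  have hF := hd.uniformContinuous_extend huc
  have hFT : ∀ z ∈ T, hd.extend (T.domRestrict f) z = f z := fun z hz =>
    hd.extend_of_ind huc ⟨z, hz⟩
  refine ⟨hd.extend (T.domRestrict f), hF, ?_, ?_, ?_⟩
  · intro z
    have hc : IsClosed {z | |hd.extend (T.domRestrict f) z| ≤ M} :=
      isClosed_le hF.continuous.abs continuous_const
    exact hc.closure_subset_iff.2 (fun z hz => by
      simpa only [mem_ofPred_eq, hFT z hz] using hM z hz) (hd z)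
  · filter_upwards [hT] with z hz
    exact (hFT z hz).symm
  · intro δ hδ z w hzw
    by_contra! hlt
    have ho : IsOpen {q : X × X | dist q.1 q.2 < 2 * δ ∧
        Ω δ < |hd.extend (T.domRestrict f) q.1 - hd.extend (T.domRestrict f) q.2|} := by
      have hc := hF.continuous
      exact (isOpen_lt (by fun_prop : Continuous fun q : X × X => dist q.1 q.2)
        continuous_const).inter (isOpen_lt continuous_const (by fun_prop : Continuous
          fun q : X × X => |hd.extend (T.domRestrict f) q.1 - hd.extend (T.domRestrict f) q.2|))
    obtain ⟨q, ⟨hq₁, hq₂⟩, hqT⟩ := (hd.prod hd).inter_open_nonempty _ ho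
      ⟨(z, w), by dsimp only; linarith, hlt⟩
    rw [hFT _ hqT.1, hFT _ hqT.2] at hq₂
    exact absurd (hosc _ hqT.1 _ hqT.2 δ hδ hq₁) (not_le.2 hq₂)

/-- The value at `r` of an antitone function, weighted by `r ^ α`, is controlled by its weighted
integral over the dyadic interval ending at `r`. -/
theorem rpow_mul_le_two_mul_integral {S : ℝ → ℝ} (hS : AntitoneOn S (Ioi 0))
    (hS0 : ∀ t, 0 ≤ S t) {α : ℝ} (hα : α ≤ 1) {r : ℝ} (hr : 0 < r)
    (hint : IntervalIntegrable (fun t => S t * t ^ (α - 1)) volume (r / 2) r) :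
    r ^ α * S r ≤ 2 * ∫ t in (r / 2)..r, S t * t ^ (α - 1) := by
  have h : ∫ _ in (r / 2)..r, S r * r ^ (α - 1) ≤ ∫ t in (r / 2)..r, S t * t ^ (α - 1) := by
    refine intervalIntegral.integral_mono_on (by linarith) (by simp) hint fun t ht => ?_
    have ht0 : 0 < t := by linarith [ht.1]
    exact mul_le_mul (hS ht0 hr ht.2) (Real.rpow_le_rpow_of_nonpos ht0 ht.2 (by linarith))
      (by positivity) (hS0 t)
  rw [intervalIntegral.integral_const, smul_eq_mul] at h
  have e : r ^ α = r * r ^ (α - 1) := by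
    rw [Real.rpow_sub_one hr.ne']; field_simp
  rw [e]
  linarith

theorem abs_sub_le_of_dist_le {f : ℝ × ℝ → ℝ} {g₁ g₂ s₁ s₂ : ℝ → ℝ} {α : ℝ} (hα : 0 < α)
    (hα1 : α ≤ 1) (hs₁ : ∀ t, 0 ≤ s₁ t) (hs₂ : ∀ t, 0 ≤ s₂ t) {w w' : ℝ × ℝ}
    (h : |f w - f w'| ≤ g₁ w.2 * |w.1 - w'.1| ^ α + g₂ w'.1 * |w.2 - w'.2| ^ α)
    {ρ ρ' : ℝ} (hρ : 0 ≤ ρ) (hρ' : 0 ≤ ρ') (h₁ : g₁ w.2 ≤ s₁ ρ) (h₂ : g₂ w'.1 ≤ s₂ ρ')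
    (hd₁ : |w.1 - w'.1| ≤ 4 * ρ) (hd₂ : |w.2 - w'.2| ≤ 4 * ρ') :
    |f w - f w'| ≤ 4 * (ρ ^ α * s₁ ρ + ρ' ^ α * s₂ ρ') := by
  have h4 : (4:ℝ) ^ α ≤ 4 := by
    simpa using Real.rpow_le_rpow_of_exponent_le (by norm_num : (1:ℝ) ≤ 4) hα1
  have key : ∀ {g s d r : ℝ}, 0 ≤ s → 0 ≤ d → 0 ≤ r → g ≤ s → d ≤ 4 * r →
      g * d ^ α ≤ 4 * (r ^ α * s) := by
    intro g s d r hs hd hr hg hdr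
    have hp : d ^ α ≤ 4 * r ^ α := by
      calc d ^ α ≤ (4 * r) ^ α := Real.rpow_le_rpow hd hdr hα.le
        _ = 4 ^ α * r ^ α := Real.mul_rpow (by norm_num) hr
        _ ≤ 4 * r ^ α := by gcongr
    calc g * d ^ α ≤ s * (4 * r ^ α) := mul_le_mul hg hp (by positivity) hs
      _ = 4 * (r ^ α * s) := by ring
  have k₁ := key (hs₁ ρ) (abs_nonneg _) hρ h₁ hd₁
  have k₂ := key (hs₂ ρ') (abs_nonneg _) hρ' h₂ hd₂
  linarith

/-- Chaining estimate: the increment of `f` between two generic points, one of which lies on a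
good horizontal line, is controlled by a Dini-type integral. -/
theorem abs_sub_le_integral_of_ae {f : ℝ × ℝ → ℝ} {g₁ g₂ s₁ s₂ : ℝ → ℝ} {α : ℝ} (hα : 0 < α)
    (hα1 : α ≤ 1) (hs₁ : ∀ t, 0 ≤ s₁ t) (hs₂ : ∀ t, 0 ≤ s₂ t)
    (ha₁ : AntitoneOn s₁ (Ioi 0)) (ha₂ : AntitoneOn s₂ (Ioi 0))
    (hb₁ : ∀ t, 0 < t → volume {x | s₁ t < g₁ x} ≤ ENNReal.ofReal t)
    (hb₂ : ∀ t, 0 < t → volume {x | s₂ t < g₂ x} ≤ ENNReal.ofReal t)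
    (hae : ∀ᵐ z : ℝ × ℝ, ∀ᵐ w : ℝ × ℝ,
      |f z - f w| ≤ g₁ z.2 * |z.1 - w.1| ^ α + g₂ w.1 * |z.2 - w.2| ^ α)
    {δ : ℝ} (hδ : 0 < δ)
    (hint : IntervalIntegrable (fun t => (s₁ t + s₂ t) * t ^ (α - 1)) volume 0 δ)
    {z w : ℝ × ℝ}
    (hz : ∀ᵐ w' : ℝ × ℝ,
      |f z - f w'| ≤ g₁ z.2 * |z.1 - w'.1| ^ α + g₂ w'.1 * |z.2 - w'.2| ^ α)
    (hw : ∀ᵐ w' : ℝ × ℝ,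
      |f w - f w'| ≤ g₁ w.2 * |w.1 - w'.1| ^ α + g₂ w'.1 * |w.2 - w'.2| ^ α)
    (hgw : g₁ w.2 ≤ s₁ δ) (hd : dist z w ≤ 3 * δ) :
    |f z - f w| ≤ 16 * ∫ t in (0:ℝ)..δ, (s₁ t + s₂ t) * t ^ (α - 1) := by
  set I : ℝ → ℝ := fun t => (s₁ t + s₂ t) * t ^ (α - 1) with hI
  have hI0 : ∀ t, 0 < t → 0 ≤ I t := fun t ht =>
    mul_nonneg (add_nonneg (hs₁ t) (hs₂ t)) (by positivity)
  let r : ℕ → ℝ := fun N => δ / 2 ^ N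
  have hr : ∀ N, 0 < r N := fun N => by positivity
  have hrδ : ∀ N, r N ≤ δ := fun N => div_le_self hδ.le (one_le_pow₀ (by norm_num))
  have hrs : ∀ N, r (N + 1) = r N / 2 := fun N => by simp only [r]; rw [pow_succ]; field_simp
  have hii : ∀ a b, 0 ≤ a → a ≤ δ → 0 ≤ b → b ≤ δ → IntervalIntegrable I volume a b :=
    fun a b ha haδ hb hbδ => hint.mono_set (by
      rw [uIcc_of_le hδ.le]; exact uIcc_subset_Icc ⟨ha, haδ⟩ ⟨hb, hbδ⟩)
  let A : ℕ → ℝ := fun N => r N ^ α * (s₁ (r N) + s₂ (r N))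
  have hA : ∀ N, A N ≤ 2 * ∫ t in (r (N + 1))..(r N), I t := fun N => by
    rw [hrs N]
    exact rpow_mul_le_two_mul_integral (S := fun t => s₁ t + s₂ t) (ha₁.add ha₂)
      (fun t => add_nonneg (hs₁ t) (hs₂ t)) hα1 (hr N)
      (hii _ _ (by linarith [hr N]) (by linarith [hr N, hrδ N]) (hr N).le (hrδ N))
  have hJ : ∀ N, ∫ t in (r (N + 2))..δ, I t =
      (∫ t in (r (N + 2))..(r (N + 1)), I t) + ∫ t in (r (N + 1))..δ, I t := fun N =>
    (intervalIntegral.integral_add_adjacent_intervals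
      (hii _ _ (hr _).le (hrδ _) (hr _).le (hrδ _)) (hii _ _ (hr _).le (hrδ _) hδ.le le_rfl)).symm
  have hsmall : ∀ N, ENNReal.ofReal (r N) < ENNReal.ofReal (2 * r N) := fun N =>
    (ENNReal.ofReal_lt_ofReal_iff (by linarith [hr N])).2 (by linarith [hr N])
  have pick : ∀ (N : ℕ) {Q : ℝ × ℝ → Prop}, (∀ᵐ w', Q w') → ∃ w' : ℝ × ℝ,
      |w'.1 - z.1| ≤ r N ∧ |w'.2 - z.2| ≤ r N ∧ g₂ w'.1 ≤ s₂ (r N) ∧ g₁ w'.2 ≤ s₁ (r N) ∧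
        Q w' := fun N Q hQ => by
    simpa only [mem_ofPred_eq, not_lt] using exists_near_of_ae z
      ((hb₂ _ (hr N)).trans_lt (hsmall N)) ((hb₁ _ (hr N)).trans_lt (hsmall N)) hQ
  have hd₁ : |w.1 - z.1| ≤ 3 * δ := by
    rw [abs_sub_comm]; exact (le_max_left _ _).trans hd
  have hd₂ : |w.2 - z.2| ≤ 3 * δ := by
    rw [abs_sub_comm]; exact (le_max_right _ _).trans hd
  have tri : ∀ {a b c x y : ℝ}, |a - c| ≤ x → |b - c| ≤ y → |a - b| ≤ x + y := by
    intro a b c x y h h'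
    calc |a - b| ≤ |a - c| + |c - b| := abs_sub_le _ _ _
      _ ≤ x + y := add_le_add h (by rwa [abs_sub_comm])
  have hgood : ∀ N, ∀ᵐ w' : ℝ × ℝ, |w'.1 - z.1| ≤ r N → |w'.2 - z.2| ≤ r N →
      g₂ w'.1 ≤ s₂ (r N) →
      |f w - f w'| ≤ 16 * (∫ t in (r (N + 1))..δ, I t) - 4 * A N := by
    intro N
    induction N with
    | zero =>
      have hr0 : r 0 = δ := by simp [r]
      filter_upwards [hw] with w' hw' h₁ h₂ hg
      rw [hr0] at h₁ h₂ hg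
      have h := abs_sub_le_of_dist_le hα hα1 hs₁ hs₂ hw' hδ.le hδ.le hgw hg
        ((tri hd₁ h₁).trans (by linarith)) ((tri hd₂ h₂).trans (by linarith))
      have hA0 := hA 0
      simp only [A, hr0] at hA0 ⊢
      rw [← mul_add] at h
      linarith
    | succ N ih =>
      obtain ⟨v, hv₁, hv₂, hvg₂, hvg₁, hv, hvae⟩ := pick N (ih.and hae)
      have hv := hv hv₁ hv₂ hvg₂
      filter_upwards [hvae] with w' hw' h₁ h₂ hg
      have h := abs_sub_le_of_dist_le hα hα1 hs₁ hs₂ hw' (hr N).le (hr (N + 1)).le hvg₁ hg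
        ((tri hv₁ h₁).trans (by linarith [hrs N, hr N]))
        ((tri hv₂ h₂).trans (by linarith [hrs N, hr N]))
      have hle : |f w - f w'| ≤ |f w - f v| + |f v - f w'| := abs_sub_le _ _ _
      have hAN := hA (N + 1)
      have p₁ : 0 ≤ r N ^ α * s₂ (r N) := mul_nonneg (Real.rpow_nonneg (hr _).le _) (hs₂ _)
      have p₂ : 0 ≤ r (N + 1) ^ α * s₁ (r (N + 1)) :=
        mul_nonneg (Real.rpow_nonneg (hr _).le _) (hs₁ _)
      rw [hJ N]
      simp only [A, mul_add] at hv hAN ⊢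
      linarith
  have hfin : ∀ N, |f z - f w| ≤ 16 * (∫ t in (0:ℝ)..δ, I t) + |g₁ z.2| * r N ^ α := by
    intro N
    obtain ⟨v, hv₁, hv₂, hvg₂, hvg₁, hv, hzv⟩ := pick N ((hgood N).and hz)
    have hv := hv hv₁ hv₂ hvg₂
    have e₁ : g₁ z.2 * |z.1 - v.1| ^ α ≤ |g₁ z.2| * r N ^ α := by
      rw [abs_sub_comm] at hv₁
      exact mul_le_mul (le_abs_self _) (Real.rpow_le_rpow (abs_nonneg _) hv₁ hα.le)
        (by positivity) (abs_nonneg _)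
    have e₂ : g₂ v.1 * |z.2 - v.2| ^ α ≤ s₂ (r N) * r N ^ α := by
      rw [abs_sub_comm] at hv₂
      exact mul_le_mul hvg₂ (Real.rpow_le_rpow (abs_nonneg _) hv₂ hα.le)
        (by positivity) (hs₂ _)
    have hle : |f z - f w| ≤ |f z - f v| + |f w - f v| := by
      rw [abs_sub_comm (f w)]; exact abs_sub_le _ _ _
    have hJ0 : (∫ t in (0:ℝ)..δ, I t) =
        (∫ t in (0:ℝ)..(r (N + 1)), I t) + ∫ t in (r (N + 1))..δ, I t :=
      (intervalIntegral.integral_add_adjacent_intervals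
        (hii _ _ le_rfl hδ.le (hr _).le (hrδ _))
        (hii _ _ (hr _).le (hrδ _) hδ.le le_rfl)).symm
    have hpos : 0 ≤ ∫ t in (0:ℝ)..(r (N + 1)), I t := by
      rw [intervalIntegral.integral_of_le (hr _).le]
      exact setIntegral_nonneg measurableSet_Ioc fun t ht => hI0 t ht.1
    have p₁ : 0 ≤ r N ^ α * s₁ (r N) := mul_nonneg (Real.rpow_nonneg (hr _).le _) (hs₁ _)
    have p₂ : 0 ≤ r N ^ α * s₂ (r N) := mul_nonneg (Real.rpow_nonneg (hr _).le _) (hs₂ _)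
    simp only [A, mul_add] at hv
    linarith
  have hr0 : Filter.Tendsto r Filter.atTop (nhds 0) := by
    have := (tendsto_pow_atTop_nhds_zero_of_lt_one (r := (1 / 2 : ℝ)) (by norm_num)
      (by norm_num)).const_mul δ
    simpa [r, div_eq_mul_inv] using this
  have hlim := ((hr0.rpow_const (Or.inr hα.le)).const_mul |g₁ z.2|).const_add
    (16 * ∫ t in (0:ℝ)..δ, I t)
  rw [Real.zero_rpow hα.ne', mul_zero, add_zero] at hlim
  exact ge_of_tendsto' hlim hfin

theorem antitoneOn_rearr {X : Type*} [MeasureSpace X] {φ L : X → ℝ} (hL : S0 L)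
    (hφ : ∀ᵐ x, |φ x| ≤ |L x|) : AntitoneOn (rearr φ) (Ioi 0) := by
  intro a ha b _ hab
  obtain ⟨s, hs, hsa⟩ := hL.exists_measure_lt_le ha
  refine rearr_le_rearr (ae_of_all _ fun _ => le_rfl) hab ⟨s, hs, le_trans (measure_mono_ae ?_) hsa⟩
  filter_upwards [hφ] with x hx hlt
  exact lt_of_lt_of_le hlt hx

theorem MemLorentz.integrableOn_rearr_mul_rpow {X : Type*} [MeasureSpace X] {p : ℝ}
    {φ L : X → ℝ} (hL : MemLorentz p 1 L) (hφ : ∀ᵐ x, |φ x| ≤ |L x|) :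
    IntegrableOn (fun t => rearr φ t * t ^ (1 / p - 1)) (Ioi 0) := by
  refine Integrable.mono' hL.2 ?_ ?_
  · exact ((aemeasurable_restrict_of_antitoneOn measurableSet_Ioi
      (antitoneOn_rearr hL.1 hφ)).mul (by fun_prop)).aestronglyMeasurable
  · filter_upwards [ae_restrict_mem measurableSet_Ioi] with t ht
    have ht0 : 0 < t := ht
    rw [Real.norm_of_nonneg (mul_nonneg (rearr_nonneg _ _) (by positivity)), Real.rpow_one,
      Real.rpow_sub_one ht0.ne', mul_comm, ← mul_div_right_comm]
    gcongr
    exact rearr_le_rearr hφ le_rfl (hL.1.exists_measure_lt_le ht0)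

theorem ae_abs_lipSemi_le_abs_lipNorm {α : ℝ} {F : ℝ → ℝ → ℝ} (h : ∀ᵐ y, MemLip α (F y)) :
    ∀ᵐ y, |lipSemi α (F y)| ≤ |lipNorm α (F y)| := by
  filter_upwards [h] with y hy
  rw [lipSemi, lipNorm, abs_of_nonneg ENNReal.toReal_nonneg, abs_of_nonneg ENNReal.toReal_nonneg]
  exact ENNReal.toReal_mono (ENNReal.add_lt_top.2 hy).ne le_add_self

theorem ae_abs_le_lipNorm {f : ℝ × ℝ → ℝ} (hf : Measurable f) {α : ℝ}
    (h : ∀ᵐ y : ℝ, MemLip α fun x => f (x, y))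
    (hm : Measurable fun y : ℝ => lipNorm α fun x => f (x, y)) :
    ∀ᵐ w : ℝ × ℝ, |f w| ≤ lipNorm α fun x => f (x, w.2) := by
  have hms : MeasurableSet {t : ℝ × ℝ | |f (t.2, t.1)| ≤ lipNorm α fun x => f (x, t.1)} :=
    measurableSet_le (by fun_prop) (hm.comp measurable_fst)
  have h' : ∀ᵐ t : ℝ × ℝ, |f (t.2, t.1)| ≤ lipNorm α fun x => f (x, t.1) := by
    rw [Measure.volume_eq_prod, Measure.ae_prod_iff_ae_ae hms]
    filter_upwards [h] with y hy
    have h1 : ∀ᵐ x : ℝ, ‖f (x, y)‖ₑ ≤ einf fun x => f (x, y) := by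
      rw [einf, eLpNorm_exponent_top]
      exact enorm_ae_le_eLpNormEssSup _ _
    filter_upwards [h1] with x hx
    rw [Real.enorm_eq_ofReal_abs] at hx
    exact (ENNReal.ofReal_le_iff_le_toReal (ENNReal.add_lt_top.2 hy).ne).1
      (hx.trans le_self_add)
  exact (Measure.measurePreserving_swap (μ := (volume : Measure ℝ))
    (ν := (volume : Measure ℝ))).quasiMeasurePreserving.ae h'

theorem measure_rearr_lt_le_of_ae_le {φ L g : ℝ → ℝ} (hL : S0 L) (hφ : ∀ᵐ x, |φ x| ≤ |L x|)
    (hg : ∀ᵐ x, g x ≤ φ x) {t : ℝ} (ht : 0 < t) :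
    volume {x | rearr φ t < g x} ≤ ENNReal.ofReal t := by
  obtain ⟨s, hs, hst⟩ := hL.exists_measure_lt_le ht
  refine le_trans (measure_mono_ae ?_) (measure_rearr_lt_le (f := φ)
    ⟨s, hs, le_trans (measure_mono_ae ?_) hst⟩)
  · filter_upwards [hg] with x hx hlt
    exact lt_of_lt_of_le hlt (hx.trans (le_abs_self _))
  · filter_upwards [hφ] with x hx hlt
    exact lt_of_lt_of_le hlt hx

/-- If `1 ≤ p < ∞` and `f ∈ U_p(ℝ²)`, then `f` agrees a.e. with a
bounded uniformly continuous function `f̄`, and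
`ω(f̄; δ) ≤ c ∫₀^δ [φ₁*(t) + φ₂*(t)] t^{1/p-1} dt` for all `δ > 0`, with `c = c(p)`. -/
theorem stmt1 (p : ℝ) (hp : 1 ≤ p) :
    ∃ c : ℝ, 0 < c ∧ ∀ f : ℝ × ℝ → ℝ, MemUp p f →
      ∃ fbar : ℝ × ℝ → ℝ,
        UniformContinuous fbar ∧
        (∃ M : ℝ, ∀ z : ℝ × ℝ, |fbar z| ≤ M) ∧
        f =ᵐ[volume] fbar ∧
        ∀ δ : ℝ, 0 < δ → ∀ x y h k : ℝ, 0 ≤ h → h ≤ δ → 0 ≤ k → k ≤ δ →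
          |fbar (x + h, y + k) - fbar (x, y)| ≤
            c * ∫ t in Ioc (0:ℝ) δ,
              (rearr (fun y' => lipSemi (1/p) (fun x' => f (x', y'))) t +
               rearr (fun x' => lipSemi (1/p) (fun y' => f (x', y'))) t) * t ^ (1/p - 1) := by
  refine ⟨32, by norm_num, fun f hf => ?_⟩
  obtain ⟨hm, hy, hx, hN₁, hN₂⟩ := hf
  have hα : 0 < 1 / p := by positivity
  have hα1 : 1 / p ≤ 1 := (div_le_one (by linarith)).2 hp
  obtain ⟨g₁, hg₁m, hg₁, hinc₁⟩ := exists_measurable_le_lipSemi hm hα (hy.mono fun _ h => h.2)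
  obtain ⟨g₂, hg₂m, hg₂, hinc₂⟩ := exists_measurable_le_lipSemi (f := fun z => f z.swap)
    (hm.comp measurable_swap) hα (hx.mono fun _ h => h.2)
  have hφ₁ := ae_abs_lipSemi_le_abs_lipNorm hy
  have hφ₂ := ae_abs_lipSemi_le_abs_lipNorm hx
  let φ₁ : ℝ → ℝ := fun y' => lipSemi (1/p) (fun x' => f (x', y'))
  let φ₂ : ℝ → ℝ := fun x' => lipSemi (1/p) (fun y' => f (x', y'))
  have hb₁ := fun t (ht : 0 < t) => measure_rearr_lt_le_of_ae_le hN₁.1 hφ₁ hg₁ ht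
  have hb₂ := fun t (ht : 0 < t) => measure_rearr_lt_le_of_ae_le hN₂.1 hφ₂ hg₂ ht
  have hae := ae_ae_abs_sub_le_add hm hg₁m hg₂m hinc₁ hinc₂
  have hint : ∀ δ : ℝ, 0 < δ →
      IntervalIntegrable (fun t => (rearr φ₁ t + rearr φ₂ t) * t ^ (1/p - 1)) volume 0 δ := by
    intro δ hδ
    rw [intervalIntegrable_iff_integrableOn_Ioc_of_le hδ.le]
    have h := (hN₁.integrableOn_rearr_mul_rpow hφ₁).add (hN₂.integrableOn_rearr_mul_rpow hφ₂)
    refine (IntegrableOn.mono_set h Ioc_subset_Ioi_self).congr_fun (fun t _ => ?_)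
      measurableSet_Ioc
    simp only [Pi.add_apply, add_mul]
    rfl
  let Ω : ℝ → ℝ := fun δ => ∫ t in (0:ℝ)..δ, (rearr φ₁ t + rearr φ₂ t) * t ^ (1/p - 1)
  let T : Set (ℝ × ℝ) := {z | ∀ᵐ w : ℝ × ℝ,
    |f z - f w| ≤ g₁ z.2 * |z.1 - w.1| ^ (1/p) + g₂ w.1 * |z.2 - w.2| ^ (1/p)}
  have hT : ∀ᵐ z, z ∈ T := hae
  have hchain : ∀ δ : ℝ, 0 < δ → ∀ z ∈ T, ∀ w ∈ T, g₁ w.2 ≤ rearr φ₁ δ → dist z w ≤ 3 * δ →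
      |f z - f w| ≤ 16 * Ω δ := fun δ hδ z hz w hw hgw hd =>
    abs_sub_le_integral_of_ae hα hα1 (rearr_nonneg _) (rearr_nonneg _)
      (antitoneOn_rearr hN₁.1 hφ₁) (antitoneOn_rearr hN₂.1 hφ₂) hb₁ hb₂ hae hδ (hint δ hδ)
      hz hw hgw hd
  have hΩ : Filter.Tendsto (fun δ => 32 * Ω δ) (nhdsWithin 0 (Ioi 0)) (nhds 0) := by
    have h1 := hint 1 one_pos
    have hc := intervalIntegral.continuousOn_primitive_interval
      (μ := volume) (a := 0) (b := (1:ℝ)) ((intervalIntegrable_iff' enorm_ne_top).1 h1)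
    have h0 := (hc 0 (by simp)).tendsto
    rw [intervalIntegral.integral_same, uIcc_of_le zero_le_one] at h0
    have h2 : nhdsWithin (0:ℝ) (Ioi 0) ≤ nhdsWithin 0 (Icc 0 1) := by
      rw [← nhdsWithin_Ioc_eq_nhdsGT (zero_lt_one' ℝ)]
      exact nhdsWithin_mono _ Ioc_subset_Icc_self
    have h3 := (h0.mono_left h2).const_mul 32
    rw [mul_zero] at h3
    exact h3
  have hosc : ∀ z ∈ T, ∀ w ∈ T, ∀ δ : ℝ, 0 < δ → dist z w < 2 * δ →
      |f z - f w| ≤ 32 * Ω δ := by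
    intro z hz w hw δ hδ hd
    have hlt : ENNReal.ofReal δ < ENNReal.ofReal (2 * δ) :=
      (ENNReal.ofReal_lt_ofReal_iff (by linarith)).2 (by linarith)
    obtain ⟨v, hv₁, hv₂, -, hvg, hvT⟩ := exists_near_of_ae z (b₁ := ∅)
      (by simpa using hδ) ((hb₁ δ hδ).trans_lt hlt) hT
    have hgv : g₁ v.2 ≤ rearr φ₁ δ := not_lt.1 hvg
    have hvz : dist v z ≤ δ := max_le hv₁ hv₂
    have e₁ := hchain δ hδ z hz v hvT hgv (by rw [dist_comm]; linarith)
    have e₂ := hchain δ hδ w hw v hvT hgv (by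
      linarith [dist_triangle w z v, dist_comm w z, dist_comm z v])
    have e₃ := abs_sub_le (f z) (f v) (f w)
    rw [abs_sub_comm (f v)] at e₃
    linarith
  obtain ⟨M, hM⟩ : ∃ M : ℝ, ∀ z ∈ T, |f z| ≤ M := by
    set L : ℝ≥0∞ := volume {y : ℝ | 1 < |lipNorm (1/p) fun x => f (x, y)|} with hL
    have hLt : L ≠ ⊤ := (hN₁.1.2 1 one_pos).ne
    have hr : 0 < L.toReal + 1 := by positivity
    refine ⟨1 + 16 * Ω (L.toReal + 1), fun z hz => ?_⟩
    obtain ⟨v, hv₁, hv₂, -, hvb, hvT, hvN⟩ := exists_near_of_ae z (r := L.toReal + 1) (b₁ := ∅)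
      (b₂ := {y | rearr φ₁ (L.toReal + 1) < g₁ y} ∪
        {y | 1 < |lipNorm (1/p) fun x => f (x, y)|})
      (by simpa using hr) (by
        refine (measure_union_le _ _).trans_lt ((add_le_add_left (hb₁ _ hr) _).trans_lt ?_)
        rw [← hL, ← ENNReal.ofReal_toReal hLt, ENNReal.toReal_ofReal ENNReal.toReal_nonneg,
          ← ENNReal.ofReal_add hr.le ENNReal.toReal_nonneg]
        exact (ENNReal.ofReal_lt_ofReal_iff (by linarith)).2 (by linarith))
      (hT.and (ae_abs_le_lipNorm hm hy hN₁.1.1))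
    simp only [mem_union, mem_ofPred_eq, not_or, not_lt] at hvb
    have hvz : dist v z ≤ L.toReal + 1 := max_le hv₁ hv₂
    have e₁ := hchain _ hr z hz v hvT hvb.1 (by rw [dist_comm]; linarith)
    have e₂ := (hvN.trans (le_abs_self _)).trans hvb.2
    linarith [abs_sub_abs_le_abs_sub (f z) (f v)]
  obtain ⟨F, hFu, hFM, hfF, hF⟩ := exists_uniformContinuous_ae_eq hT hΩ hosc hM
  refine ⟨F, hFu, ⟨M, hFM⟩, hfF, fun δ hδ x y h k hh hhδ hk hkδ => ?_⟩
  rw [← intervalIntegral.integral_of_le hδ.le]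
  refine hF δ hδ _ _ (max_le ?_ ?_)
  · simpa [Real.dist_eq, abs_of_nonneg hh] using hhδ
  · simpa [Real.dist_eq, abs_of_nonneg hk] using hkδ

end
end

section
/- Let 1 ≤ p < ∞, let f ∈ U_p(ℝ²), and for h > 0 set f_h(x,y) = h^{−2} ∫₀^h ∫₀^h f(x+u, y+v) du dv and g_h = f − f_h. Then g_h ∈ S₀(ℝ²) and its non-increasing rearrangement satisfies g_h*(h²) ≤ 2 h^{1/p} [φ₁**(h) + φ₂**(h)], where φ₁(y) = ‖f_y‖*_{Lip 1/p}, φ₂(x) = ‖f_x‖*_{Lip 1/p}, and φ**(t) = (1/t)∫₀^t φ*(u) du. -/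
open MeasureTheory Set
open scoped ENNReal

noncomputable section

/-- The levels defining `φ*(u)` form a nonempty set for every `u > 0`. -/
def HasRearr (φ : ℝ → ℝ) : Prop :=
  ∀ u : ℝ, 0 < u → ∃ s : ℝ, 0 ≤ s ∧ volume {x | s < |φ x|} ≤ ENNReal.ofReal u

lemma bddBelow_rearr_levels (φ : ℝ → ℝ) (u : ℝ) :
    BddBelow {s : ℝ | 0 ≤ s ∧ volume {x | s < |φ x|} ≤ ENNReal.ofReal u} :=
  ⟨0, fun _ hs => hs.1⟩

lemma rearr_nonneg_s8 (φ : ℝ → ℝ) (u : ℝ) : 0 ≤ rearr φ u :=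
  Real.sInf_nonneg fun _ hs => hs.1

lemma volume_abs_gt_mono {φ ψ : ℝ → ℝ} (h : ∀ᵐ x, |φ x| ≤ |ψ x|) {s t : ℝ} (hst : s ≤ t) :
    volume {x | t < |φ x|} ≤ volume {x | s < |ψ x|} := by
  apply measure_mono_ae
  filter_upwards [h] with x hx hxt
  exact lt_of_le_of_lt hst (lt_of_lt_of_le hxt hx)

lemma HasRearr.mono {φ ψ : ℝ → ℝ} (h : ∀ᵐ x, |φ x| ≤ |ψ x|) (hψ : HasRearr ψ) :
    HasRearr φ := by
  intro u hu
  obtain ⟨s, hs, hs'⟩ := hψ u hu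
  exact ⟨s, hs, (volume_abs_gt_mono h le_rfl).trans hs'⟩

lemma rearr_mono {φ ψ : ℝ → ℝ} (h : ∀ᵐ x, |φ x| ≤ |ψ x|) (hψ : HasRearr ψ) {u : ℝ}
    (hu : 0 < u) : rearr φ u ≤ rearr ψ u :=
  csInf_le_csInf (bddBelow_rearr_levels φ u) (hψ u hu)
    fun _ hs => ⟨hs.1, (volume_abs_gt_mono h le_rfl).trans hs.2⟩

lemma HasRearr.antitoneOn {φ : ℝ → ℝ} (hφ : HasRearr φ) : AntitoneOn (rearr φ) (Ioi 0) :=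
  fun u hu _ _ huv => csInf_le_csInf (bddBelow_rearr_levels φ _) (hφ u hu)
    fun _ hs => ⟨hs.1, hs.2.trans (ENNReal.ofReal_le_ofReal huv)⟩

lemma S0.hasRearr {φ : ℝ → ℝ} (hφ : S0 φ) : HasRearr φ := by
  intro u hu
  have hmeas : ∀ n : ℕ, MeasurableSet {x | ((n : ℝ) + 1) < |φ x|} := fun n =>
    measurableSet_lt measurable_const (_root_.continuous_abs.measurable.comp hφ.1)
  have hlim := tendsto_measure_iInter_atTop (μ := volume)
    (s := fun n : ℕ => {x | ((n : ℝ) + 1) < |φ x|}) (fun n => (hmeas n).nullMeasurableSet)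
    (fun n m hnm x (hx : (m : ℝ) + 1 < |φ x|) =>
      show (n : ℝ) + 1 < |φ x| from lt_of_le_of_lt (by gcongr) hx)
    ⟨0, (hφ.2 _ (by positivity)).ne⟩
  have hempty : (⋂ n : ℕ, {x | ((n : ℝ) + 1) < |φ x|}) = ∅ := by
    ext x
    simp only [mem_iInter, mem_ofPred_eq, mem_empty_iff_false, iff_false, not_forall, not_lt]
    obtain ⟨n, hn⟩ := exists_nat_ge |φ x|
    exact ⟨n, by linarith⟩
  rw [hempty, measure_empty] at hlim
  obtain ⟨n, hn⟩ := (hlim.eventually (gt_mem_nhds (ENNReal.ofReal_pos.2 hu))).exists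
  exact ⟨(n : ℝ) + 1, by positivity, hn.le⟩

lemma volume_gt_rearr_le {φ : ℝ → ℝ} (hφ : HasRearr φ) {u : ℝ} (hu : 0 < u) :
    volume {x | rearr φ u < |φ x|} ≤ ENNReal.ofReal u := by
  have hunion : {x | rearr φ u < |φ x|} =
      ⋃ n : ℕ, {x | rearr φ u + 1 / ((n : ℝ) + 1) < |φ x|} := by
    ext x
    simp only [mem_ofPred_eq, mem_iUnion]
    constructor
    · intro hx
      obtain ⟨n, hn⟩ := exists_nat_one_div_lt (sub_pos.2 hx)
      exact ⟨n, by linarith⟩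
    · rintro ⟨n, hn⟩
      have : 0 < 1 / ((n : ℝ) + 1) := by positivity
      linarith
  rw [hunion, Monotone.measure_iUnion]
  · refine iSup_le fun n => ?_
    have hlt : rearr φ u < rearr φ u + 1 / ((n : ℝ) + 1) :=
      lt_add_of_pos_right _ (by positivity)
    obtain ⟨s, hs, hs'⟩ := exists_lt_of_csInf_lt (hφ u hu) hlt
    exact (volume_abs_gt_mono (Filter.Eventually.of_forall fun _ => le_rfl) hs'.le).trans hs.2
  · intro n m hnm x (hx : rearr φ u + 1 / ((n : ℝ) + 1) < |φ x|)
    change rearr φ u + 1 / ((m : ℝ) + 1) < |φ x|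
    refine lt_of_le_of_lt ?_ hx
    gcongr

/-- Hardy–Littlewood: integrals of a minorant of `|φ|` against a measure of total mass at most `T`
dominated by Lebesgue measure are bounded by the integral of `φ*` over `(0, T]`. -/
lemma lintegral_le_lintegral_rearr {φ G : ℝ → ℝ} (hφ : HasRearr φ) (hG : Measurable G)
    (hG0 : ∀ x, 0 ≤ G x) (hGφ : ∀ᵐ x, G x ≤ |φ x|) {ν : Measure ℝ} (hν : ν ≤ volume)
    {T : ℝ} (hT : ν univ ≤ ENNReal.ofReal T) :
    ∫⁻ x, ENNReal.ofReal (G x) ∂ν ≤ ∫⁻ u in Ioc 0 T, ENNReal.ofReal (rearr φ u) := by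
  rw [lintegral_eq_lintegral_meas_lt _ (Filter.Eventually.of_forall hG0) hG.aemeasurable,
    lintegral_eq_lintegral_meas_le _ (Filter.Eventually.of_forall (rearr_nonneg_s8 φ))
      (aemeasurable_restrict_of_antitoneOn measurableSet_Ioc
        (hφ.antitoneOn.mono fun x hx => hx.1))]
  refine setLIntegral_mono' measurableSet_Ioi fun t _ => ?_
  set m := volume {x | t < |φ x|} with hm
  have h1 : ν {x | t < G x} ≤ m := by
    refine (hν _).trans (measure_mono_ae ?_)
    filter_upwards [hGφ] with x hx hxt using lt_of_lt_of_le hxt hx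
  have h2 : ν {x | t < G x} ≤ ENNReal.ofReal T := (measure_mono (subset_univ _)).trans hT
  have key : ∀ u, 0 < u → ENNReal.ofReal u < m → t ≤ rearr φ u := by
    intro u hu hum
    refine le_csInf (hφ u hu) fun s hs => ?_
    by_contra! hst
    refine absurd hum (not_lt.2 (le_trans ?_ hs.2))
    exact volume_abs_gt_mono (Filter.Eventually.of_forall fun _ => le_rfl) hst.le
  have hlow : ∀ r : ℝ, r ≤ T → ENNReal.ofReal r ≤ m →
      ENNReal.ofReal r ≤ (volume.restrict (Ioc 0 T)) {u | t ≤ rearr φ u} := by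
    intro r hrT hrm
    calc ENNReal.ofReal r = volume (Ioo 0 r) := by simp
      _ = (volume.restrict (Ioc 0 T)) (Ioo 0 r) := by
        rw [Measure.restrict_apply measurableSet_Ioo, inter_eq_left.2]
        exact fun u hu => ⟨hu.1, hu.2.le.trans hrT⟩
      _ ≤ _ := measure_mono fun u hu => key u hu.1
        (lt_of_lt_of_le ((ENNReal.ofReal_lt_ofReal_iff (hu.1.trans hu.2)).2 hu.2) hrm)
  rcases le_total (ENNReal.ofReal T) m with hTm | hTm
  · exact h2.trans (hlow T le_rfl hTm)
  · have hmtop : m ≠ ⊤ := ne_top_of_le_ne_top ENNReal.ofReal_ne_top hTm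
    rcases le_or_gt 0 T with hT0 | hT0
    · have := hlow m.toReal (ENNReal.toReal_le_of_le_ofReal hT0 hTm)
        (ENNReal.ofReal_toReal hmtop).le
      rw [ENNReal.ofReal_toReal hmtop] at this
      exact h1.trans this
    · rw [ENNReal.ofReal_of_nonpos hT0.le] at h2
      exact h2.trans zero_le

lemma MemLorentz.integrableOn_rearr {p : ℝ} (hp : 1 ≤ p) {N : ℝ → ℝ} (hN : MemLorentz p 1 N)
    (T : ℝ) : IntegrableOn (rearr N) (Ioc 0 T) := by
  rcases le_or_gt T 0 with hT | hT
  · simp [Ioc_eq_empty (not_lt.2 hT)]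
  have hdom : IntegrableOn (fun t => T ^ (1 - 1 / p) * ((t ^ (1/p) * rearr N t) ^ (1:ℝ) / t))
      (Ioc 0 T) := (hN.2.mono_set fun x hx => hx.1).const_mul _
  refine hdom.mono' (aemeasurable_restrict_of_antitoneOn measurableSet_Ioc
    (hN.1.hasRearr.antitoneOn.mono fun x hx => hx.1)).aestronglyMeasurable ?_
  refine (ae_restrict_iff' measurableSet_Ioc).2 (Filter.Eventually.of_forall fun t ht => ?_)
  have hp' : 0 ≤ 1 - 1 / p := by
    rw [sub_nonneg, div_le_one (by linarith)]; exact hp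
  have ht0 : 0 < t := ht.1
  rw [Real.norm_of_nonneg (rearr_nonneg_s8 _ _), Real.rpow_one]
  have h1 : t ^ (1 - 1 / p) * (t ^ (1 / p)) = t := by
    rw [← Real.rpow_add ht0]; simp
  calc rearr N t = (t ^ (1 - 1 / p) * (t ^ (1 / p)) / t) * rearr N t := by
        rw [h1, div_self ht0.ne', one_mul]
    _ ≤ (T ^ (1 - 1 / p) * (t ^ (1 / p)) / t) * rearr N t := by
        have := rearr_nonneg_s8 N t
        have := ht.2
        gcongr
    _ = _ := by ring

lemma integrableOn_rearr_of_le {φ N : ℝ → ℝ} (h : ∀ᵐ x, |φ x| ≤ |N x|) (hN : HasRearr N)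
    {T : ℝ} (hNT : IntegrableOn (rearr N) (Ioc 0 T)) : IntegrableOn (rearr φ) (Ioc 0 T) := by
  refine hNT.mono' (aemeasurable_restrict_of_antitoneOn measurableSet_Ioc
    ((hN.mono h).antitoneOn.mono fun x hx => hx.1)).aestronglyMeasurable ?_
  refine (ae_restrict_iff' measurableSet_Ioc).2 (Filter.Eventually.of_forall fun t ht => ?_)
  rw [Real.norm_of_nonneg (rearr_nonneg_s8 _ _)]
  exact rearr_mono h hN ht.1

lemma rearr_le_doubleStar {φ : ℝ → ℝ} (hφ : HasRearr φ) {t : ℝ} (ht : 0 < t)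
    (hint : IntegrableOn (rearr φ) (Ioc 0 t)) : rearr φ t ≤ doubleStar φ t := by
  rw [doubleStar, le_div_iff₀ ht]
  calc rearr φ t * t = ∫ _ in Ioc 0 t, rearr φ t := by simp [ht.le, mul_comm]
    _ ≤ _ := setIntegral_mono_on (by simp) hint measurableSet_Ioc
      fun u hu => hφ.antitoneOn hu.1 ht hu.2

lemma doubleStar_nonneg (φ : ℝ → ℝ) {t : ℝ} (ht : 0 < t) : 0 ≤ doubleStar φ t :=
  div_nonneg (integral_nonneg fun _ => rearr_nonneg_s8 _ _) ht.le

lemma lintegral_rearr_eq {φ : ℝ → ℝ} {t : ℝ} (ht : 0 < t)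
    (hint : IntegrableOn (rearr φ) (Ioc 0 t)) :
    ∫⁻ u in Ioc 0 t, ENNReal.ofReal (rearr φ u) = ENNReal.ofReal (t * doubleStar φ t) := by
  rw [doubleStar, mul_div_cancel₀ _ ht.ne', ofReal_integral_eq_lintegral_ofReal hint
    (Filter.Eventually.of_forall (rearr_nonneg_s8 φ))]

/-- Moving-window version of the Hardy–Littlewood bound. -/
lemma lintegral_translate_le {φ G : ℝ → ℝ} (hφ : HasRearr φ) (hG : Measurable G)
    (hG0 : ∀ x, 0 ≤ G x) (hGφ : ∀ᵐ x, G x ≤ |φ x|) (h x : ℝ) :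
    ∫⁻ u in Ioc 0 h, ENNReal.ofReal (G (x + u)) ≤
      ∫⁻ u in Ioc 0 h, ENNReal.ofReal (rearr φ u) := by
  have hmap : ∫⁻ u in Ioc 0 h, ENNReal.ofReal (G (x + u)) =
      ∫⁻ y, ENNReal.ofReal (G y) ∂((volume.restrict (Ioc 0 h)).map (fun u => x + u)) := by
    rw [lintegral_map hG.ennreal_ofReal (measurable_const_add x)]
  rw [hmap]
  refine lintegral_le_lintegral_rearr hφ hG hG0 hGφ ?_ ?_
  · calc _ ≤ (volume : Measure ℝ).map (fun u => x + u) :=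
        Measure.map_mono Measure.restrict_le_self (measurable_const_add x)
      _ = volume := (measurePreserving_add_left volume x).map_eq
  · rw [Measure.map_apply (measurable_const_add x) MeasurableSet.univ]
    simp

/-- The moving averages of a function whose rearrangement is locally integrable have finite
distribution function. -/
lemma volume_lintegral_translate_gt_lt_top {N : ℝ → ℝ} (hN : S0 N) (hN0 : ∀ x, 0 ≤ N x)
    (hint : ∀ T, IntegrableOn (rearr N) (Ioc 0 T)) {h : ℝ} (hh : 0 < h) {s : ℝ} (hs : 0 < s) :
    volume {x | ENNReal.ofReal (h * s) < ∫⁻ u in Ioc 0 h, ENNReal.ofReal (N (x + u))} < ⊤ := by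
  set E := {x | s / 2 < N x} with hE
  have hEm : MeasurableSet E := measurableSet_lt measurable_const hN.1
  have hEfin : volume E < ⊤ := by
    have := hN.2 (s / 2) (by linarith)
    simpa only [abs_of_nonneg (hN0 _)] using this
  set F : ℝ → ℝ≥0∞ := E.indicator fun x => ENNReal.ofReal (N x) with hF
  have hFm : Measurable F := hN.1.ennreal_ofReal.indicator hEm
  have hFint : ∫⁻ x, F x < ⊤ := by
    rw [hF, lintegral_indicator hEm]
    refine lt_of_le_of_lt (lintegral_le_lintegral_rearr (T := (volume E).toReal) hN.hasRearr hN.1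
      hN0 (Filter.Eventually.of_forall fun x => le_abs_self _) Measure.restrict_le_self ?_) ?_
    · rw [ENNReal.ofReal_toReal hEfin.ne, Measure.restrict_apply_univ]
    · rw [← ofReal_integral_eq_lintegral_ofReal (hint _)
        (Filter.Eventually.of_forall (rearr_nonneg_s8 N))]
      exact ENNReal.ofReal_lt_top
  have hAm : Measurable fun x => ∫⁻ u in Ioc 0 h, F (x + u) :=
    Measurable.lintegral_prod_right' (f := fun z : ℝ × ℝ => F (z.1 + z.2))
      (hFm.comp (measurable_fst.add measurable_snd))
  have hAint : ∫⁻ x, ∫⁻ u in Ioc 0 h, F (x + u) < ⊤ := by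
    rw [lintegral_lintegral_swap (f := fun x u => F (x + u))
      (hFm.comp (measurable_fst.add measurable_snd)).aemeasurable]
    simp_rw [lintegral_add_right_eq_self F]
    simp only [lintegral_const, Measure.restrict_apply_univ, Real.volume_Ioc, sub_zero]
    exact ENNReal.mul_lt_top hFint ENNReal.ofReal_lt_top
  have hpos : ENNReal.ofReal (h * (s / 2)) ≠ 0 := by
    simp only [ne_eq, ENNReal.ofReal_eq_zero, not_le]; positivity
  have hsub : {x | ENNReal.ofReal (h * s) < ∫⁻ u in Ioc 0 h, ENNReal.ofReal (N (x + u))} ⊆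
      {x | ENNReal.ofReal (h * (s / 2)) ≤ ∫⁻ u in Ioc 0 h, F (x + u)} := by
    intro x hx
    by_contra hlt
    simp only [mem_ofPred_eq, not_le] at hlt hx
    refine absurd hx (not_lt.2 ?_)
    calc ∫⁻ u in Ioc 0 h, ENNReal.ofReal (N (x + u))
        ≤ ∫⁻ u in Ioc 0 h, (F (x + u) + ENNReal.ofReal (s / 2)) := by
          refine lintegral_mono fun u => ?_
          by_cases hu : x + u ∈ E
          · simp [hF, hu]
          · refine le_trans (ENNReal.ofReal_le_ofReal ?_) le_add_self
            exact not_lt.1 hu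
      _ = (∫⁻ u in Ioc 0 h, F (x + u)) + ENNReal.ofReal (h * (s / 2)) := by
          rw [lintegral_add_right _ measurable_const, setLIntegral_const, Real.volume_Ioc,
            sub_zero, ← ENNReal.ofReal_mul (by positivity), mul_comm (s / 2)]
      _ ≤ ENNReal.ofReal (h * (s / 2)) + ENNReal.ofReal (h * (s / 2)) := by gcongr
      _ = ENNReal.ofReal (h * s) := by
          rw [← ENNReal.ofReal_add (by positivity) (by positivity)]; congr 1; ring
  refine lt_of_le_of_lt (measure_mono hsub) (lt_of_le_of_lt
    (meas_ge_le_lintegral_div hAm.aemeasurable hpos ENNReal.ofReal_ne_top) ?_)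
  exact ENNReal.div_lt_top hAint.ne hpos

lemma lipSemi_nonneg (α : ℝ) (φ : ℝ → ℝ) : 0 ≤ lipSemi α φ := ENNReal.toReal_nonneg

lemma lipNorm_nonneg (α : ℝ) (φ : ℝ → ℝ) : 0 ≤ lipNorm α φ := ENNReal.toReal_nonneg

lemma MemLip.lipSemi_le_lipNorm {α : ℝ} {φ : ℝ → ℝ} (hφ : MemLip α φ) :
    lipSemi α φ ≤ lipNorm α φ :=
  ENNReal.toReal_mono (ENNReal.add_lt_top.2 hφ).ne le_add_self

lemma MemLip.ae_abs_le {α : ℝ} {φ : ℝ → ℝ} (hφ : MemLip α φ) :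
    ∀ᵐ x, |φ x| ≤ lipNorm α φ := by
  have h := ae_le_eLpNormEssSup (f := φ) (μ := volume)
  filter_upwards [h] with x hx
  have hx' : ‖φ x‖ₑ ≤ einf φ + lipSemiE α φ := by
    refine hx.trans ?_
    rw [einf, eLpNorm_exponent_top]
    exact le_self_add
  have := ENNReal.toReal_mono (ENNReal.add_lt_top.2 hφ).ne hx'
  simpa [lipNorm] using this

lemma ae_increment_le {α : ℝ} (φ : ℝ → ℝ) {v : ℝ} (hv : 0 < v) :
    ∀ᵐ x, ENNReal.ofReal (|φ (x + v) - φ x| / v ^ α) ≤ lipSemiE α φ := by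
  have h := ae_le_eLpNormEssSup (f := fun x => φ (x + v) - φ x) (μ := volume)
  filter_upwards [h] with x hx
  refine le_trans ?_ (le_iSup₂ (f := fun h (_ : h ∈ Ioi (0:ℝ)) =>
    ENNReal.ofReal (h ^ (-α)) * einf (fun x => φ (x + h) - φ x)) v hv)
  rw [einf, eLpNorm_exponent_top, div_eq_inv_mul, ← Real.rpow_neg hv.le,
    ENNReal.ofReal_mul (Real.rpow_nonneg hv.le _), ← Real.norm_eq_abs, ofReal_norm]
  gcongr

section Fubini

variable {X Y : Type*} [MeasurableSpace X] [MeasurableSpace Y]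

lemma measurableSet_ae_section {ν : Measure Y} [SFinite ν] {P : X × Y → Prop}
    (hP : MeasurableSet {z | P z}) : MeasurableSet {x | ∀ᵐ y ∂ν, P (x, y)} :=
  measurable_measure_prodMk_left hP.compl (measurableSet_singleton 0)

lemma measurable_essSup_section {ν : Measure Y} [SFinite ν] {F : X × Y → ℝ≥0∞}
    (hF : Measurable F) : Measurable fun x => essSup (fun y => F (x, y)) ν := by
  refine measurable_of_Iic fun c => ?_
  have : (fun x => essSup (fun y => F (x, y)) ν) ⁻¹' Iic c = {x | ∀ᵐ y ∂ν, F (x, y) ≤ c} := by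
    ext x
    constructor
    · intro hx
      have hle : ∀ᵐ y ∂ν, F (x, y) ≤ essSup (fun y => F (x, y)) ν := ae_le_essSup
      filter_upwards [hle] with y hy using hy.trans hx
    · exact fun hx => essSup_le_of_ae_le c hx
  rw [this]
  exact measurableSet_ae_section (P := fun z => F z ≤ c) (hF measurableSet_Iic)

end Fubini

lemma ae_add_right {P : ℝ × ℝ → Prop} (hP : ∀ᵐ z, P z) (w : ℝ × ℝ) : ∀ᵐ z, P (z + w) :=
  (measurePreserving_add_right volume w).quasiMeasurePreserving.ae hP

lemma ae_swap {P : ℝ × ℝ → Prop} (hP : ∀ᵐ z, P z) : ∀ᵐ z : ℝ × ℝ, P z.swap :=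
  (Measure.measurePreserving_swap (μ := (volume : Measure ℝ))
    (ν := (volume : Measure ℝ))).quasiMeasurePreserving.ae hP

/-- Lebesgue measure on the window `(0, h]`. -/
abbrev window (h : ℝ) : Measure ℝ := volume.restrict (Ioc 0 h)

/-- The increments of `f` in the second variable are a.e. controlled by a measurable function of
the first variable lying below the Lipschitz seminorms of the sections. -/
lemma exists_measurable_increment_bound {α : ℝ} (hα : 0 ≤ α) {f : ℝ × ℝ → ℝ} (hf : Measurable f)
    (hlip : ∀ᵐ x, MemLip α (fun y => f (x, y))) {h : ℝ} (hh : 0 < h) :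
    ∃ G : ℝ → ℝ, Measurable G ∧ (∀ x, 0 ≤ G x) ∧
      (∀ᵐ x, G x ≤ lipSemi α (fun y => f (x, y))) ∧
      ∀ᵐ z : ℝ × ℝ, ∀ᵐ v ∂window h, |f (z.1, z.2 + v) - f z| ≤ h ^ α * G z.1 := by
  have hc : 0 < h ^ α := Real.rpow_pos_of_pos hh α
  set F : ℝ × (ℝ × ℝ) → ℝ≥0∞ := fun q =>
    ENNReal.ofReal (|f (q.1, q.2.1 + q.2.2) - f (q.1, q.2.1)| / h ^ α) with hF
  have hFm : Measurable F := by
    have h1 : Measurable fun q : ℝ × (ℝ × ℝ) => f (q.1, q.2.1 + q.2.2) :=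
      hf.comp (by fun_prop)
    have h2 : Measurable fun q : ℝ × (ℝ × ℝ) => f (q.1, q.2.1) := hf.comp (by fun_prop)
    exact ((_root_.continuous_abs.measurable.comp (h1.sub h2)).div_const _).ennreal_ofReal
  set K : ℝ → ℝ≥0∞ := fun x => essSup (fun q => F (x, q)) ((volume : Measure ℝ).prod (window h))
    with hK
  have hKm : Measurable K := measurable_essSup_section hFm
  have hKle : ∀ x, K x ≤ lipSemiE α (fun y => f (x, y)) := by
    intro x
    refine essSup_le_of_ae_le _ ?_
    have hm : MeasurableSet {q : ℝ × ℝ | F (x, q) ≤ lipSemiE α (fun y => f (x, y))} :=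
      (hFm.comp measurable_prodMk_left) measurableSet_Iic
    refine (Measure.ae_prod_iff_ae_ae hm).2 ?_
    refine (Measure.ae_ae_comm hm).2 ?_
    refine (ae_restrict_iff' measurableSet_Ioc).2 (Filter.Eventually.of_forall fun v hv => ?_)
    filter_upwards [ae_increment_le (α := α) (fun y => f (x, y)) hv.1] with y hy
    refine le_trans (ENNReal.ofReal_le_ofReal ?_) hy
    have := Real.rpow_pos_of_pos hv.1 α
    have := Real.rpow_le_rpow hv.1.le hv.2 hα
    dsimp only
    gcongr
  refine ⟨fun x => (K x).toReal, hKm.ennreal_toReal, fun _ => ENNReal.toReal_nonneg, ?_, ?_⟩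
  · filter_upwards [hlip] with x hx using ENNReal.toReal_mono hx.2.ne (hKle x)
  · set Q : (ℝ × ℝ) × ℝ → Prop := fun q =>
      |f (q.1.1, q.1.2 + q.2) - f q.1| ≤ h ^ α * (K q.1.1).toReal with hQ
    have hQm : MeasurableSet {q | Q q} := by
      have h1 : Measurable fun q : (ℝ × ℝ) × ℝ => f (q.1.1, q.1.2 + q.2) :=
        hf.comp (by fun_prop)
      refine measurableSet_le (_root_.continuous_abs.measurable.comp
        (h1.sub (hf.comp measurable_fst))) ?_
      exact (hKm.ennreal_toReal.comp (measurable_fst.comp measurable_fst)).const_mul _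
    have hQs := measurableSet_ae_section (ν := window h) hQm
    refine (Measure.ae_prod_iff_ae_ae hQs).2 ?_
    filter_upwards [hlip] with x hx
    have hle : ∀ᵐ q ∂((volume : Measure ℝ).prod (window h)), F (x, q) ≤ K x := ae_le_essSup
    filter_upwards [Measure.ae_ae_of_ae_prod hle] with y hy
    filter_upwards [hy] with v hv
    have hKtop : K x ≠ ⊤ := ne_top_of_le_ne_top hx.2.ne (hKle x)
    have := ENNReal.toReal_mono hKtop hv
    rw [hF, ENNReal.toReal_ofReal (by positivity), div_le_iff₀ hc] at this
    exact this.trans (mul_comm _ _).le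

/-- The average of `f` over the square `z + (0, h]²`. -/
def squareAvg (f : ℝ × ℝ → ℝ) (h : ℝ) (z : ℝ × ℝ) : ℝ :=
  (∫ w, f (z + w) ∂(window h).prod (window h)) / h ^ 2

lemma squareAvg_swap (f : ℝ × ℝ → ℝ) (h : ℝ) (z : ℝ × ℝ) :
    squareAvg (fun z : ℝ × ℝ => f z.swap) h z.swap = squareAvg f h z := by
  rw [squareAvg, squareAvg, ← integral_prod_swap]
  rfl

lemma measurable_avg {f : ℝ × ℝ → ℝ} (hf : Measurable f) (h : ℝ) : Measurable (avg f h) := by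
  refine Measurable.div_const ?_ _
  have h1 : StronglyMeasurable fun q : (ℝ × ℝ) × ℝ =>
      ∫ v in Ioc (0:ℝ) h, f (q.1.1 + q.2, q.1.2 + v) := by
    refine StronglyMeasurable.integral_prod_right
      (f := fun (q : (ℝ × ℝ) × ℝ) (v : ℝ) => f (q.1.1 + q.2, q.1.2 + v)) ?_
    exact (hf.comp (by fun_prop)).stronglyMeasurable
  exact (StronglyMeasurable.integral_prod_right
    (f := fun (z : ℝ × ℝ) (u : ℝ) => ∫ v in Ioc (0:ℝ) h, f (z.1 + u, z.2 + v)) h1).measurable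

lemma lintegral_window_prod_fst {G : ℝ → ℝ} (hG : Measurable G) (h x : ℝ) :
    ∫⁻ w, ENNReal.ofReal (G (x + w.1)) ∂(window h).prod (window h) =
      (∫⁻ u in Ioc 0 h, ENNReal.ofReal (G (x + u))) * ENNReal.ofReal h := by
  rw [lintegral_prod _ ((show Measurable fun w : ℝ × ℝ => G (x + w.1) from
    hG.comp (by fun_prop)).ennreal_ofReal.aemeasurable)]
  simp only [lintegral_const, Measure.restrict_apply_univ, Real.volume_Ioc, sub_zero]
  rw [lintegral_mul_const _ (show Measurable fun u : ℝ => G (x + u) from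
    hG.comp (measurable_const_add x)).ennreal_ofReal]

lemma ae_ae_window_of_ae {P : ℝ × ℝ → Prop} (hP : MeasurableSet {z | P z}) (h : ∀ᵐ z, P z)
    (r : ℝ) : ∀ᵐ z : ℝ × ℝ, ∀ᵐ w ∂(window r).prod (window r), P (z + w) := by
  have hm : MeasurableSet {q : (ℝ × ℝ) × (ℝ × ℝ) | P (q.1 + q.2)} :=
    (measurable_fst.add measurable_snd) hP
  exact (Measure.ae_ae_comm hm).2 (Filter.Eventually.of_forall fun w => ae_add_right h w)

/-- The increment bound over squares. -/
lemma ae_ae_square_increment_le {f : ℝ × ℝ → ℝ} (hf : Measurable f) {G₁ G₂ : ℝ → ℝ}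
    (hG₂ : Measurable G₂) {c h : ℝ}
    (h₁ : ∀ᵐ z : ℝ × ℝ, ∀ᵐ u ∂window h, |f (z.1 + u, z.2) - f z| ≤ c * G₁ z.2)
    (h₂ : ∀ᵐ z : ℝ × ℝ, ∀ᵐ v ∂window h, |f (z.1, z.2 + v) - f z| ≤ c * G₂ z.1) :
    ∀ᵐ z : ℝ × ℝ, ∀ᵐ w ∂(window h).prod (window h),
      |f (z + w) - f z| ≤ c * (G₂ (z.1 + w.1) + G₁ z.2) := by
  have h₂' : ∀ᵐ z : ℝ × ℝ, ∀ᵐ u ∂window h, ∀ᵐ v ∂window h,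
      |f (z.1 + u, z.2 + v) - f (z.1 + u, z.2)| ≤ c * G₂ (z.1 + u) := by
    have hm : MeasurableSet {q : ((ℝ × ℝ) × ℝ) × ℝ |
        |f (q.1.1.1 + q.1.2, q.1.1.2 + q.2) - f (q.1.1.1 + q.1.2, q.1.1.2)| ≤
          c * G₂ (q.1.1.1 + q.1.2)} := by
      have a1 : Measurable fun q : ((ℝ × ℝ) × ℝ) × ℝ => f (q.1.1.1 + q.1.2, q.1.1.2 + q.2) :=
        hf.comp (by fun_prop)
      have a2 : Measurable fun q : ((ℝ × ℝ) × ℝ) × ℝ => f (q.1.1.1 + q.1.2, q.1.1.2) :=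
        hf.comp (by fun_prop)
      have a3 : Measurable fun q : ((ℝ × ℝ) × ℝ) × ℝ => G₂ (q.1.1.1 + q.1.2) :=
        hG₂.comp (by fun_prop)
      exact measurableSet_le (_root_.continuous_abs.measurable.comp (a1.sub a2)) (a3.const_mul c)
    refine (Measure.ae_ae_comm (p := fun (z : ℝ × ℝ) (u : ℝ) => ∀ᵐ v ∂window h,
      |f (z.1 + u, z.2 + v) - f (z.1 + u, z.2)| ≤ c * G₂ (z.1 + u))
      (measurableSet_ae_section (ν := window h) hm)).2 (Filter.Eventually.of_forall fun u => ?_)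
    filter_upwards [ae_add_right h₂ (u, 0)] with z hz
    simpa [Prod.add_def] using hz
  filter_upwards [h₁, h₂'] with z hz₁ hz₂
  have hm : MeasurableSet {w : ℝ × ℝ | |f (z + w) - f z| ≤ c * (G₂ (z.1 + w.1) + G₁ z.2)} := by
    have a1 : Measurable fun w : ℝ × ℝ => f (z + w) := hf.comp (by fun_prop)
    have a2 : Measurable fun w : ℝ × ℝ => G₂ (z.1 + w.1) := hG₂.comp (by fun_prop)
    exact measurableSet_le (_root_.continuous_abs.measurable.comp (a1.sub_const _))
      ((a2.add_const _).const_mul c)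
  refine (Measure.ae_prod_iff_ae_ae hm).2 ?_
  filter_upwards [hz₁, hz₂] with u hu₁ hu₂
  filter_upwards [hu₂] with v hv
  have : f (z + (u, v)) - f z =
      (f (z.1 + u, z.2 + v) - f (z.1 + u, z.2)) + (f (z.1 + u, z.2) - f z) := by
    simp [Prod.add_def]
  rw [this, mul_add]
  exact (abs_add_le _ _).trans (add_le_add hv hu₁)

lemma MemUp.swap {p : ℝ} {f : ℝ × ℝ → ℝ} (hf : MemUp p f) :
    MemUp p (fun z : ℝ × ℝ => f z.swap) :=
  ⟨hf.1.comp measurable_swap, hf.2.2.1, hf.2.1, hf.2.2.2.2, hf.2.2.2.1⟩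

lemma MemUp.ae_abs_le {p : ℝ} {f : ℝ × ℝ → ℝ} (hf : MemUp p f) :
    ∀ᵐ z : ℝ × ℝ, |f z| ≤ lipNorm (1/p) (fun y => f (z.1, y)) := by
  have hN : Measurable fun x => lipNorm (1/p) (fun y => f (x, y)) := hf.2.2.2.2.1.1
  have hm : MeasurableSet {z : ℝ × ℝ | |f z| ≤ lipNorm (1/p) (fun y => f (z.1, y))} :=
    measurableSet_le (_root_.continuous_abs.measurable.comp hf.1) (hN.comp measurable_fst)
  refine (Measure.ae_prod_iff_ae_ae hm).2 ?_
  filter_upwards [hf.2.2.1] with x hx using hx.ae_abs_le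

lemma MemUp.ae_abs_lipSemi_le {p : ℝ} {f : ℝ × ℝ → ℝ} (hf : MemUp p f) :
    ∀ᵐ x, |lipSemi (1/p) (fun y => f (x, y))| ≤ |lipNorm (1/p) (fun y => f (x, y))| := by
  filter_upwards [hf.2.2.1] with x hx
  rw [abs_of_nonneg (lipSemi_nonneg _ _), abs_of_nonneg (lipNorm_nonneg _ _)]
  exact hx.lipSemi_le_lipNorm

lemma MemUp.hasRearr_lipSemi {p : ℝ} {f : ℝ × ℝ → ℝ} (hf : MemUp p f) :
    HasRearr fun x => lipSemi (1/p) (fun y => f (x, y)) :=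
  hf.2.2.2.2.1.hasRearr.mono hf.ae_abs_lipSemi_le

lemma MemUp.integrableOn_rearr_lipSemi {p : ℝ} (hp : 1 ≤ p) {f : ℝ × ℝ → ℝ} (hf : MemUp p f)
    (T : ℝ) : IntegrableOn (rearr fun x => lipSemi (1/p) (fun y => f (x, y))) (Ioc 0 T) :=
  integrableOn_rearr_of_le hf.ae_abs_lipSemi_le hf.2.2.2.2.1.hasRearr
    (hf.2.2.2.2.integrableOn_rearr hp T)

lemma MemUp.ae_lintegral_square_le {p : ℝ} {f : ℝ × ℝ → ℝ} (hf : MemUp p f) (h : ℝ) :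
    ∀ᵐ z : ℝ × ℝ, ∫⁻ w, ‖f (z + w)‖ₑ ∂(window h).prod (window h) ≤
      (∫⁻ u in Ioc 0 h, ENNReal.ofReal (lipNorm (1/p) (fun y => f (z.1 + u, y)))) *
        ENNReal.ofReal h := by
  have hN : Measurable fun x => lipNorm (1/p) (fun y => f (x, y)) := hf.2.2.2.2.1.1
  have hm : MeasurableSet {z : ℝ × ℝ | |f z| ≤ lipNorm (1/p) (fun y => f (z.1, y))} :=
    measurableSet_le (_root_.continuous_abs.measurable.comp hf.1) (hN.comp measurable_fst)
  filter_upwards [ae_ae_window_of_ae hm hf.ae_abs_le h] with z hz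
  rw [← lintegral_window_prod_fst hN]
  refine lintegral_mono_ae ?_
  filter_upwards [hz] with w hw
  rw [← ofReal_norm]
  exact ENNReal.ofReal_le_ofReal hw

lemma MemUp.ae_integrable_square {p : ℝ} (hp : 1 ≤ p) {f : ℝ × ℝ → ℝ} (hf : MemUp p f) (h : ℝ) :
    ∀ᵐ z : ℝ × ℝ, Integrable (fun w => f (z + w)) ((window h).prod (window h)) := by
  have hN := hf.2.2.2.2
  filter_upwards [hf.ae_lintegral_square_le h] with z hz
  refine ⟨(hf.1.comp (measurable_const_add z)).aestronglyMeasurable, lt_of_le_of_lt hz ?_⟩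
  refine ENNReal.mul_lt_top (lt_of_le_of_lt (lintegral_translate_le hN.1.hasRearr hN.1.1
    (fun _ => lipNorm_nonneg _ _) (Filter.Eventually.of_forall fun x => le_abs_self _) h z.1) ?_)
    ENNReal.ofReal_lt_top
  rw [← ofReal_integral_eq_lintegral_ofReal (hN.integrableOn_rearr hp h)
    (Filter.Eventually.of_forall (rearr_nonneg_s8 _))]
  exact ENNReal.ofReal_lt_top

lemma MemUp.ae_avg_eq {p : ℝ} (hp : 1 ≤ p) {f : ℝ × ℝ → ℝ} (hf : MemUp p f) (h : ℝ) :
    ∀ᵐ z : ℝ × ℝ, avg f h z = squareAvg f h z := by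
  filter_upwards [hf.ae_integrable_square hp h] with z hz
  rw [avg, squareAvg, integral_prod _ hz]
  rfl

lemma MemUp.ae_squareAvg_le {p : ℝ} {f : ℝ × ℝ → ℝ} (hf : MemUp p f) {h : ℝ} (hh : 0 < h) :
    ∀ᵐ z : ℝ × ℝ, ENNReal.ofReal (h * |squareAvg f h z|) ≤
      ∫⁻ u in Ioc 0 h, ENNReal.ofReal (lipNorm (1/p) (fun y => f (z.1 + u, y))) := by
  filter_upwards [hf.ae_lintegral_square_le h] with z hz
  have h0 : ENNReal.ofReal h ≠ 0 := by simpa using hh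
  refine (ENNReal.mul_le_mul_iff_left h0 ENNReal.ofReal_ne_top).1 (le_trans ?_ hz)
  refine le_trans ?_ (enorm_integral_le_lintegral_enorm _)
  rw [← ENNReal.ofReal_mul (by positivity), ← ofReal_norm, Real.norm_eq_abs]
  refine ENNReal.ofReal_le_ofReal (le_of_eq ?_)
  rw [squareAvg, abs_div, abs_of_pos (by positivity : 0 < h ^ 2)]
  field_simp

/-- The pointwise bound for `f - f_h` by a section seminorm and an averaged seminorm. -/
lemma MemUp.ae_sub_squareAvg_le {p : ℝ} (hp : 1 ≤ p) {f : ℝ × ℝ → ℝ} (hf : MemUp p f) {h : ℝ}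
    (hh : 0 < h) :
    ∀ᵐ z : ℝ × ℝ, |f z - squareAvg f h z| ≤ h ^ (1/p) *
      (lipSemi (1/p) (fun x => f (x, z.2)) +
        doubleStar (fun x => lipSemi (1/p) (fun y => f (x, y))) h) := by
  have hα : 0 ≤ 1 / p := by positivity
  set c := h ^ (1/p) with hc
  have hc0 : 0 < c := Real.rpow_pos_of_pos hh _
  set B := doubleStar (fun x => lipSemi (1/p) (fun y => f (x, y))) h with hB
  have hB0 : 0 ≤ B := doubleStar_nonneg _ hh
  obtain ⟨G₂, hG₂, hG₂0, hG₂le, hG₂f⟩ :=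
    exists_measurable_increment_bound hα hf.1 hf.2.2.1 hh
  obtain ⟨G₁, hG₁, hG₁0, hG₁le, hG₁f⟩ :=
    exists_measurable_increment_bound hα hf.swap.1 hf.swap.2.2.1 hh
  have hG₁le' : ∀ᵐ z : ℝ × ℝ, G₁ z.2 ≤ lipSemi (1/p) (fun x => f (x, z.2)) :=
    Measure.quasiMeasurePreserving_snd.ae hG₁le
  filter_upwards [hf.ae_integrable_square hp h, hG₁le',
    ae_ae_square_increment_le hf.1 hG₂ (ae_swap hG₁f) hG₂f] with z hint hz₁ hz
  have hG₂int : ∫⁻ u in Ioc 0 h, ENNReal.ofReal (G₂ (z.1 + u)) ≤ ENNReal.ofReal (h * B) := by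
    rw [hB, ← lintegral_rearr_eq hh (hf.integrableOn_rearr_lipSemi hp h)]
    refine lintegral_translate_le hf.hasRearr_lipSemi hG₂ hG₂0 ?_ h z.1
    filter_upwards [hG₂le] with x hx using hx.trans (le_abs_self _)
  have hmass : ((window h).prod (window h)) univ = ENNReal.ofReal (h ^ 2) := by
    rw [← univ_prod_univ, Measure.prod_prod]
    simp [sq, ENNReal.ofReal_mul hh.le]
  have hdiff : h ^ 2 * (f z - squareAvg f h z) =
      ∫ w, (f z - f (z + w)) ∂(window h).prod (window h) := by
    rw [integral_sub (integrable_const _) hint, integral_const, Measure.real, hmass,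
      ENNReal.toReal_ofReal (by positivity), squareAvg, smul_eq_mul]
    field_simp
  have hbound : ENNReal.ofReal (h ^ 2 * |f z - squareAvg f h z|) ≤
      ENNReal.ofReal (h ^ 2 * (c * (G₁ z.2 + B))) := by
    calc ENNReal.ofReal (h ^ 2 * |f z - squareAvg f h z|)
        = ‖∫ w, (f z - f (z + w)) ∂(window h).prod (window h)‖ₑ := by
          rw [← hdiff, ← ofReal_norm, norm_mul, Real.norm_of_nonneg (by positivity),
            Real.norm_eq_abs]
      _ ≤ ∫⁻ w, ‖f z - f (z + w)‖ₑ ∂(window h).prod (window h) :=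
          enorm_integral_le_lintegral_enorm _
      _ ≤ ∫⁻ w, ENNReal.ofReal c * (ENNReal.ofReal (G₂ (z.1 + w.1)) + ENNReal.ofReal (G₁ z.2))
            ∂(window h).prod (window h) := by
          refine lintegral_mono_ae ?_
          filter_upwards [hz] with w hw
          rw [← ofReal_norm, Real.norm_eq_abs, abs_sub_comm,
            ← ENNReal.ofReal_add (hG₂0 _) (hG₁0 _), ← ENNReal.ofReal_mul hc0.le]
          exact ENNReal.ofReal_le_ofReal hw
      _ = ENNReal.ofReal c * ((∫⁻ u in Ioc 0 h, ENNReal.ofReal (G₂ (z.1 + u))) *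
            ENNReal.ofReal h + ENNReal.ofReal (G₁ z.2) * ENNReal.ofReal (h ^ 2)) := by
          rw [lintegral_const_mul' _ _ ENNReal.ofReal_ne_top,
            lintegral_add_right _ measurable_const, lintegral_window_prod_fst hG₂,
            lintegral_const, hmass]
      _ ≤ ENNReal.ofReal c * (ENNReal.ofReal (h * B) * ENNReal.ofReal h +
            ENNReal.ofReal (G₁ z.2) * ENNReal.ofReal (h ^ 2)) := by gcongr
      _ = ENNReal.ofReal (h ^ 2 * (c * (G₁ z.2 + B))) := by
          have := hG₁0 z.2
          rw [← ENNReal.ofReal_mul (by positivity), ← ENNReal.ofReal_mul (hG₁0 _),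
            ← ENNReal.ofReal_add (by positivity) (by positivity), ← ENNReal.ofReal_mul hc0.le]
          congr 1; ring
  have := hG₁0 z.2
  have hfin := le_of_mul_le_mul_left
    ((ENNReal.ofReal_le_ofReal_iff (by positivity)).1 hbound) (by positivity : 0 < h ^ 2)
  exact hfin.trans (by gcongr)

/-- If `1 ≤ p < ∞`, `f ∈ U_p(ℝ²)`, `h > 0`, and
`g_h = f - f_h` where `f_h` is the Steklov average, then `g_h ∈ S₀(ℝ²)` and
`g_h*(h²) ≤ 2 h^{1/p} [φ₁**(h) + φ₂**(h)]`. -/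
theorem stmt8 (p : ℝ) (hp : 1 ≤ p) (f : ℝ × ℝ → ℝ) (hf : MemUp p f)
    (h : ℝ) (hh : 0 < h) :
    S0 (fun z => f z - avg f h z) ∧
    rearr (fun z => f z - avg f h z) (h ^ 2) ≤
      2 * h ^ (1/p) *
        (doubleStar (fun y => lipSemi (1/p) (fun x => f (x, y))) h +
         doubleStar (fun x => lipSemi (1/p) (fun y => f (x, y))) h) := by
  have hfs := hf.swap
  have havg := hf.ae_avg_eq hp h
  set φ₁ : ℝ → ℝ := fun y => lipSemi (1/p) (fun x => f (x, y)) with hφ₁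
  set φ₂ : ℝ → ℝ := fun x => lipSemi (1/p) (fun y => f (x, y)) with hφ₂
  refine ⟨⟨hf.1.sub (measurable_avg hf.1 h), fun s hs => ?_⟩, ?_⟩
  · set N₁ : ℝ → ℝ := fun y => lipNorm (1/p) (fun x => f (x, y)) with hN₁
    set N₂ : ℝ → ℝ := fun x => lipNorm (1/p) (fun y => f (x, y)) with hN₂
    have hM₁ : MemLorentz p 1 N₁ := hf.2.2.2.1
    have hM₂ : MemLorentz p 1 N₂ := hf.2.2.2.2
    have hs2 : 0 < s / 2 := by linarith
    set A : (ℝ → ℝ) → Set ℝ := fun N =>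
      {x | ENNReal.ofReal (h * (s / 2)) < ∫⁻ u in Ioc 0 h, ENNReal.ofReal (N (x + u))} with hA
    have hle : volume {z | s < |f z - avg f h z|} ≤
        volume (({x | s / 2 < |N₂ x|} ×ˢ {y | s / 2 < |N₁ y|}) ∪ (A N₂ ×ˢ A N₁)) := by
      refine measure_mono_ae ?_
      filter_upwards [havg, hf.ae_abs_le, ae_swap hfs.ae_abs_le, hf.ae_squareAvg_le hh,
        ae_swap (hfs.ae_squareAvg_le hh)] with z hz hz₁ hz₂ hz₃ hz₄ (hzs : s < _)
      rw [squareAvg_swap] at hz₄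
      rw [hz] at hzs
      have htri : |f z - squareAvg f h z| ≤ |f z| + |squareAvg f h z| := abs_sub _ _
      rcases lt_or_ge (s / 2) |f z| with hlt | hge
      · exact Or.inl ⟨lt_of_lt_of_le hlt (hz₁.trans (le_abs_self _)),
          lt_of_lt_of_le hlt (hz₂.trans (le_abs_self _))⟩
      · have hlt : ENNReal.ofReal (h * (s / 2)) < ENNReal.ofReal (h * |squareAvg f h z|) := by
          have : s / 2 < |squareAvg f h z| := by linarith
          rw [ENNReal.ofReal_lt_ofReal_iff (mul_pos hh (hs2.trans this))]
          gcongr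
        exact Or.inr ⟨lt_of_lt_of_le hlt hz₃, lt_of_lt_of_le hlt hz₄⟩
    refine lt_of_le_of_lt (hle.trans (measure_union_le _ _)) ?_
    rw [Measure.volume_eq_prod, Measure.prod_prod, Measure.prod_prod]
    exact ENNReal.add_lt_top.2 ⟨ENNReal.mul_lt_top (hM₂.1.2 _ hs2) (hM₁.1.2 _ hs2),
      ENNReal.mul_lt_top
        (volume_lintegral_translate_gt_lt_top hM₂.1 (fun _ => lipNorm_nonneg _ _)
          (hM₂.integrableOn_rearr hp) hh hs2)
        (volume_lintegral_translate_gt_lt_top hM₁.1 (fun _ => lipNorm_nonneg _ _)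
          (hM₁.integrableOn_rearr hp) hh hs2)⟩
  · have hA0 : 0 ≤ doubleStar φ₁ h := doubleStar_nonneg _ hh
    have hB0 : 0 ≤ doubleStar φ₂ h := doubleStar_nonneg _ hh
    have hc0 : 0 < h ^ (1/p) := Real.rpow_pos_of_pos hh _
    have hR₁ : rearr φ₁ h ≤ doubleStar φ₁ h :=
      rearr_le_doubleStar hfs.hasRearr_lipSemi hh (hfs.integrableOn_rearr_lipSemi hp h)
    have hR₂ : rearr φ₂ h ≤ doubleStar φ₂ h :=
      rearr_le_doubleStar hf.hasRearr_lipSemi hh (hf.integrableOn_rearr_lipSemi hp h)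
    refine csInf_le ⟨0, fun _ hs => hs.1⟩ ⟨by positivity, ?_⟩
    calc volume {z | 2 * h ^ (1/p) * (doubleStar φ₁ h + doubleStar φ₂ h) < |f z - avg f h z|}
        ≤ volume ({x | rearr φ₂ h < |φ₂ x|} ×ˢ {y | rearr φ₁ h < |φ₁ y|}) := by
          refine measure_mono_ae ?_
          filter_upwards [havg, hf.ae_sub_squareAvg_le hp hh,
            ae_swap (hfs.ae_sub_squareAvg_le hp hh)] with z hz hz₁ hz₂ (hzs : _ < _)
          rw [squareAvg_swap] at hz₂
          rw [hz, mul_comm (2:ℝ), mul_assoc] at hzs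
          have h₁ : 2 * (doubleStar φ₁ h + doubleStar φ₂ h) < φ₁ z.2 + doubleStar φ₂ h :=
            lt_of_mul_lt_mul_left (hzs.trans_le hz₁) hc0.le
          have h₂ : 2 * (doubleStar φ₁ h + doubleStar φ₂ h) < φ₂ z.1 + doubleStar φ₁ h :=
            lt_of_mul_lt_mul_left (hzs.trans_le hz₂) hc0.le
          have h₃ := le_abs_self (φ₁ z.2)
          have h₄ := le_abs_self (φ₂ z.1)
          exact ⟨show rearr φ₂ h < |φ₂ z.1| by linarith, show rearr φ₁ h < |φ₁ z.2| by linarith⟩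
      _ ≤ ENNReal.ofReal h * ENNReal.ofReal h := by
          rw [Measure.volume_eq_prod, Measure.prod_prod]
          exact mul_le_mul' (volume_gt_rearr_le hf.hasRearr_lipSemi hh)
            (volume_gt_rearr_le hfs.hasRearr_lipSemi hh)
      _ = ENNReal.ofReal (h ^ 2) := by rw [← ENNReal.ofReal_mul hh.le, sq]

end
end
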